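/- arXiv:1806.06851 — 6 statements merged into one kernel-verified Lean document; each statement's English description precedes it below -/
import Mathlib

section
/- Let G be a δ-graph on n ≥ 4 vertices. Then G has an orthogonal representation in ℝ^{Δ(Ḡ)+1}, where Ḡ is the complement of G; consequently msr(G) ≤ Δ(Ḡ) + 1 = |G| − δ(G). -/
open SimpleGraph
open scoped RealInnerProductSpace

/-- An orthogonal representation of a simple graph `G` in `ℝ^d`: an assignment of a vector
to each vertex so that, for distinct vertices, the inner product is nonzero iff they are
adjacent. -/
def HasOrthoRep {V : Type*} (G : SimpleGraph V) (d : ℕ) : Prop :=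
  ∃ f : V → EuclideanSpace ℝ (Fin d),
    ∀ i j : V, i ≠ j → (⟪f i, f j⟫ ≠ 0 ↔ G.Adj i j)

/-- The minimum semidefinite rank of `G`: the smallest `d` such that `G` has an
orthogonal representation in `ℝ^d`. -/
noncomputable def msr {V : Type*} (G : SimpleGraph V) : ℕ :=
  sInf {d : ℕ | HasOrthoRep G d}

/-- `v : Fin n ≃ V` is a δ-labeling of `G`: `G` and its complement are connected, `n ≥ 4`,
the induced subgraph on the first three labeled vertices has at most one edge
(i.e. it is `3K₁` or `K₂ ⊔ K₁`), and for `m ≥ 4` the `m`-th vertex (index `k = m - 1`)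
is adjacent to all prior vertices except at most `⌊m/2 - 1⌋` of them. -/
def IsDeltaLabeling {V : Type*} {n : ℕ} (G : SimpleGraph V) (v : Fin n ≃ V) : Prop :=
  4 ≤ n ∧ G.Connected ∧ Gᶜ.Connected ∧
  {p : Fin n × Fin n | p.1.val < p.2.val ∧ p.2.val < 3 ∧ G.Adj (v p.1) (v p.2)}.ncard ≤ 1 ∧
  ∀ k : Fin n, 3 ≤ k.val →
    {i : Fin n | i.val < k.val ∧ ¬ G.Adj (v k) (v i)}.ncard ≤ (k.val + 1) / 2 - 1

/-- `G` is a δ-graph if its vertices admit a δ-labeling. -/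
def IsDeltaGraph {V : Type*} (G : SimpleGraph V) : Prop :=
  ∃ (n : ℕ) (v : Fin n ≃ V), IsDeltaLabeling G v

open Classical in
/-- A leveling of a finite graph: a proper coloring `b` by natural numbers in which every vertex
`v` has exactly `b v` neighbors of smaller color and, for each `i ≤ b v`, at least `i` neighbors
of color less than `i`. -/
structure IsLeveling {V : Type*} [Fintype V] (H : SimpleGraph V) (b : V → ℕ) : Prop where
  ne_of_adj : ∀ u v, H.Adj u v → b u ≠ b v
  card_lower : ∀ v, (Finset.univ.filter fun u => H.Adj v u ∧ b u < b v).card = b v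
  le_card : ∀ v, ∀ i ≤ b v, i ≤ (Finset.univ.filter fun u => H.Adj v u ∧ b u < i).card

open Classical in
/-- Stage `n` of the greedy construction of a leveling: the levels below `n` are final and the
remaining vertices carry the label `n`. -/
theorem exists_leveling_below {V : Type*} [Fintype V] (H : SimpleGraph V) (n : ℕ) :
    ∃ b : V → ℕ, (∀ v, b v ≤ n) ∧ (∀ u v, b u < n → H.Adj u v → b u ≠ b v) ∧
      (∀ v, b v < n → (Finset.univ.filter fun u => H.Adj v u ∧ b u < b v).card = b v) ∧
      ∀ v, ∀ i ≤ b v, i ≤ (Finset.univ.filter fun u => H.Adj v u ∧ b u < i).card := by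
  induction n with
  | zero => exact ⟨fun _ => 0, by simp, by simp, by simp, by simp⟩
  | succ n ih =>
    obtain ⟨b, hle, hne, hcard, hlow⟩ := ih
    let P : Finset V → Prop := fun C =>
      (∀ v ∈ C, b v = n ∧ (Finset.univ.filter fun u => H.Adj v u ∧ b u < n).card = n) ∧
        ∀ u ∈ C, ∀ v ∈ C, ¬ H.Adj u v
    have hne' : (Finset.univ.filter P).Nonempty := ⟨∅, by simp [P]⟩
    obtain ⟨C, hC⟩ := Finset.exists_maximal hne'
    obtain ⟨hC1, hC2⟩ : P C := by simpa using hC.1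
    let b' : V → ℕ := fun v => if b v < n ∨ v ∈ C then b v else n + 1
    have hb'lt : ∀ u i, i ≤ n → (b' u < i ↔ b u < i) := by
      intro u i hi
      by_cases h : b u < n ∨ u ∈ C
      · simp [b', h]
      · have := hle u
        simp only [b', h, if_false]
        push Not at h
        omega
    have hcount : ∀ v i, i ≤ n → (Finset.univ.filter fun u => H.Adj v u ∧ b' u < i) =
        Finset.univ.filter fun u => H.Adj v u ∧ b u < i := by
      intro v i hi
      ext u
      simp [hb'lt u i hi]
    refine ⟨b', ?_, ?_, ?_, ?_⟩
    · intro v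
      have := hle v
      simp only [b']
      split_ifs <;> omega
    · intro u v hu huv
      have h1 := hle u
      have h2 := hle v
      by_cases hu' : b u < n ∨ u ∈ C
      · by_cases hv' : b v < n ∨ v ∈ C
        · simp only [b', hu', hv', if_true]
          by_cases hun : b u < n
          · exact hne u v hun huv
          by_cases hvn : b v < n
          · exact (hne v u hvn huv.symm).symm
          exact absurd huv (hC2 u (hu'.resolve_left hun) v (hv'.resolve_left hvn))
        · simp only [b', hu', hv', if_true, if_false]
          omega
      · simp only [b', hu', if_false] at hu
        omega
    · intro v hv
      by_cases hv' : b v < n ∨ v ∈ C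
      · have hbv : b' v = b v := by simp [b', hv']
        rw [hbv, hcount v _ (hle v)]
        by_cases hvn : b v < n
        · exact hcard v hvn
        · obtain ⟨h3, h4⟩ := hC1 v (hv'.resolve_left hvn)
          rw [h3, h4]
      · simp only [b', hv', if_false] at hv
        omega
    · intro v i hi
      by_cases hin : i ≤ n
      · rw [hcount v i hin]
        refine hlow v i (le_of_not_gt fun h => ?_)
        have := (hb'lt v i hin).2 h
        omega
      · have h1 := hle v
        by_cases hv' : b v < n ∨ v ∈ C
        · simp only [b', hv', if_true] at hi
          omega
        simp only [b', hv', if_false] at hi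
        obtain rfl : i = n + 1 := by omega
        push Not at hv'
        have hbv : b v = n := by omega
        have hge : n ≤ (Finset.univ.filter fun u => H.Adj v u ∧ b u < n).card :=
          hlow v n hbv.ge
        have hsub : (Finset.univ.filter fun u => H.Adj v u ∧ b u < n) ⊆
            Finset.univ.filter fun u => H.Adj v u ∧ b' u < n + 1 := by
          intro u
          simp only [Finset.mem_filter, Finset.mem_univ, true_and]
          intro h
          exact ⟨h.1, ((hb'lt u n le_rfl).2 h.2).trans (Nat.lt_succ_self n)⟩
        rcases hge.lt_or_eq with hlt | heq
        · exact (Nat.succ_le_of_lt hlt).trans (Finset.card_le_card hsub)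
        obtain ⟨w, hwC, hw⟩ : ∃ w ∈ C, H.Adj v w := by
          by_contra! hno
          have hins : insert v C ∈ Finset.univ.filter P := by
            refine Finset.mem_filter.2 ⟨Finset.mem_univ _, ?_, ?_⟩
            · intro x hx
              rcases Finset.mem_insert.1 hx with rfl | hx
              · exact ⟨hbv, heq.symm⟩
              · exact hC1 x hx
            · intro x hx y hy
              rcases Finset.mem_insert.1 hx with hxv | hxC <;>
                rcases Finset.mem_insert.1 hy with hyv | hyC
              · exact hxv ▸ hyv ▸ H.loopless.irrefl v
              · exact hxv ▸ hno y hyC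
              · exact fun h => hno x hxC (hyv ▸ h.symm)
              · exact hC2 x hxC y hyC
          exact hv'.2 (hC.2 hins (Finset.subset_insert v C) (Finset.mem_insert_self v C))
        have hwn : b w = n := (hC1 w hwC).1
        refine Nat.succ_le_of_lt (heq.trans_lt (Finset.card_lt_card ⟨hsub, fun h => ?_⟩))
        have : w ∈ Finset.univ.filter fun u => H.Adj v u ∧ b u < n :=
          h (by simp [hw, b', hwC, hwn])
        simp [hwn] at this

/-- Every finite graph has a leveling with at most `H.maxDegree + 1` levels. -/
theorem exists_isLeveling {V : Type*} [Fintype V] (H : SimpleGraph V) [DecidableRel H.Adj] :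
    ∃ b : V → ℕ, IsLeveling H b ∧ ∀ v, b v ≤ H.maxDegree := by
  classical
  obtain ⟨b, -, hne, hcard, hlow⟩ := exists_leveling_below H (H.maxDegree + 1)
  have hlt : ∀ v, b v ≤ H.maxDegree := by
    intro v
    refine (hlow v (b v) le_rfl).trans (le_trans (Finset.card_le_card ?_) (H.degree_le_maxDegree v))
    intro u hu
    simp only [Finset.mem_filter] at hu
    simpa using hu.2.1
  exact ⟨b, ⟨fun u v h => hne u v (Nat.lt_succ_of_le (hlt u)) h,
    fun v => hcard v (Nat.lt_succ_of_le (hlt v)), hlow⟩, hlt⟩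

/-- A finite set is `b`-dense if, for each `i` up to its size, it has at least `i` elements of
level less than `i`. -/
def LevelDense {V : Type*} (b : V → ℕ) (S : Finset V) : Prop :=
  ∀ i ≤ S.card, i ≤ (S.filter fun s => b s < i).card

namespace LevelDense

variable {V : Type*} {b : V → ℕ} {S : Finset V}

theorem lt_card (hS : LevelDense b S) {s : V} (hs : s ∈ S) : b s < S.card := by
  have h := Finset.eq_of_subset_of_card_le (Finset.filter_subset _ S) (hS S.card le_rfl)
  rw [← h] at hs
  exact (Finset.mem_filter.1 hs).2

theorem erase [DecidableEq V] (hS : LevelDense b S) {z : V} (hz : z ∈ S)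
    (hmax : ∀ s ∈ S, b s ≤ b z) : LevelDense b (S.erase z) := by
  intro i hi
  rw [Finset.card_erase_of_mem hz] at hi
  by_cases hiz : i ≤ b z
  · have : ((S.erase z).filter fun s => b s < i) = S.filter fun s => b s < i := by
      ext s
      simp only [Finset.mem_filter, Finset.mem_erase]
      constructor
      · exact fun h => ⟨h.1.2, h.2⟩
      · rintro ⟨h1, h2⟩
        exact ⟨⟨fun h => by subst h; omega, h1⟩, h2⟩
    rw [this]
    exact hS i (by omega)
  · rw [Finset.filter_true_of_mem, Finset.card_erase_of_mem hz]
    · exact hi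
    · intro s hs
      have := hmax s (Finset.mem_of_mem_erase hs)
      omega

theorem insert [DecidableEq V] (hS : LevelDense b S) {z : V} (hz : z ∉ S) (hb : b z ≤ S.card) :
    LevelDense b (insert z S) := by
  intro i hi
  rw [Finset.card_insert_of_notMem hz] at hi
  rcases Nat.lt_succ_iff_lt_or_eq.1 (Nat.lt_succ_of_le hi) with h | rfl
  · exact (hS i (by omega)).trans
      (Finset.card_le_card (Finset.filter_subset_filter _ (Finset.subset_insert z S)))
  · rw [Finset.filter_true_of_mem, Finset.card_insert_of_notMem hz]
    intro s hs
    rcases Finset.mem_insert.1 hs with rfl | hs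
    · omega
    · exact (hS.lt_card hs).trans (Nat.lt_succ_self _)

theorem exists_subset_card_eq (hS : LevelDense b S) {k : ℕ} (hk : k ≤ S.card) :
    ∃ T ⊆ S, LevelDense b T ∧ T.card = k := by
  classical
  induction S using Finset.strongInduction with
  | H S ih =>
    rcases hk.eq_or_lt with rfl | hlt
    · exact ⟨S, subset_rfl, hS, rfl⟩
    obtain ⟨z, hz, hmax⟩ := S.exists_max_image b (Finset.card_pos.1 (by omega))
    obtain ⟨T, hT, hT', hTk⟩ := ih _ (Finset.erase_ssubset hz) (hS.erase hz hmax)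
      (by rw [Finset.card_erase_of_mem hz]; omega)
    exact ⟨T, hT.trans (Finset.erase_subset z S), hT', hTk⟩

end LevelDense

open Classical in
/-- The neighbors of `v` of smaller level. -/
noncomputable def lowerNeighbors {V : Type*} [Fintype V] (H : SimpleGraph V) (b : V → ℕ) (v : V) :
    Finset V :=
  Finset.univ.filter fun u => H.Adj v u ∧ b u < b v

theorem mem_lowerNeighbors {V : Type*} [Fintype V] {H : SimpleGraph V} {b : V → ℕ} {u v : V} :
    u ∈ lowerNeighbors H b v ↔ H.Adj v u ∧ b u < b v := by
  simp [lowerNeighbors]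

namespace IsLeveling

variable {V : Type*} [Fintype V] {H : SimpleGraph V} {b : V → ℕ}

theorem card_lowerNeighbors (hb : IsLeveling H b) (v : V) :
    (lowerNeighbors H b v).card = b v :=
  hb.card_lower v

theorem levelDense_lowerNeighbors (hb : IsLeveling H b) (v : V) :
    LevelDense b (lowerNeighbors H b v) := by
  intro i hi
  rw [hb.card_lowerNeighbors] at hi
  refine (hb.le_card v i hi).trans (Finset.card_le_card ?_)
  intro u
  simp only [Finset.mem_filter, mem_lowerNeighbors, Finset.mem_univ, true_and]
  exact fun h => ⟨⟨h.1, h.2.trans_le hi⟩, h.2⟩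

end IsLeveling

/-- The cross Gram matrix `(⟪x s, x t⟫)`, `s ∈ S`, `t ∈ T`, has linearly independent columns. -/
def CrossIndep {V E : Type*} [NormedAddCommGroup E] [InnerProductSpace ℝ E] (x : V → E)
    (S T : Finset V) : Prop :=
  LinearIndependent ℝ fun (t : T) (s : S) => ⟪x s, x t⟫

section CrossIndep

variable {V E F : Type*} [NormedAddCommGroup E] [InnerProductSpace ℝ E]
  [NormedAddCommGroup F] [InnerProductSpace ℝ F] {x : V → E} {S T : Finset V}

theorem CrossIndep.congr (h : CrossIndep x S T) {y : V → F}
    (hxy : ∀ s ∈ S, ∀ t ∈ T, ⟪y s, y t⟫ = ⟪x s, x t⟫) : CrossIndep y S T := by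
  unfold CrossIndep at *
  convert h using 3 with t s
  exact hxy s s.2 t t.2

theorem CrossIndep.linearIndepOn (h : CrossIndep x S T) : LinearIndepOn ℝ x (T : Set V) :=
  LinearIndependent.of_comp (LinearMap.pi fun s : S => (innerₗ E (x s))) h

theorem CrossIndep.eq_zero_of_mem_span (h : CrossIndep x S T) {w : E}
    (hw : w ∈ Submodule.span ℝ (x '' (T : Set V))) (hS : ∀ s ∈ S, ⟪x s, w⟫ = 0) : w = 0 := by
  obtain ⟨c, rfl⟩ := (Submodule.mem_span_image_finset_iff_exists_fun ℝ).1 hw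
  have hc := Fintype.linearIndependent_iff.1 h c (by
    ext s
    have := hS s s.2
    simpa [inner_sum, inner_smul_right] using this)
  simp [hc]

theorem crossIndep_of_linearIndepOn (hT : LinearIndepOn ℝ x (T : Set V))
    (h : ∀ w ∈ Submodule.span ℝ (x '' (T : Set V)), (∀ s ∈ S, ⟪x s, w⟫ = 0) → w = 0) :
    CrossIndep x S T := by
  refine Fintype.linearIndependent_iff.2 fun c hc => ?_
  have hsum : ∑ t : T, c t • x t = 0 := by
    refine h _ ((Submodule.mem_span_image_finset_iff_exists_fun ℝ).2 ⟨c, rfl⟩) fun s hs => ?_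
    have := congrFun hc ⟨s, hs⟩
    simpa [inner_sum, inner_smul_right] using this
  exact Fintype.linearIndependent_iff.1 hT c hsum

theorem isOpen_setOf_crossIndep (S T : Finset V) : IsOpen {x : V → E | CrossIndep x S T} := by
  have hc : Continuous fun (x : V → E) (t : T) (s : S) => ⟪x s, x t⟫ := by fun_prop
  exact isOpen_setOfPred_linearIndependent.preimage hc

/-- If `y a` is orthogonal to the vectors `y r`, `r ∈ R`, whose Gram matrix is invertible, then
`y a` extends continuously to a vector orthogonal to the `x r` for varying `x`. -/
theorem CrossIndep.exists_continuous_orthogonal {y : V → E} {R : Finset V}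
    (h : CrossIndep y R R) {a : V} (ha : ∀ r ∈ R, ⟪y r, y a⟫ = 0) :
    ∃ g : (V → E) → E, Continuous g ∧ g y = y a ∧ ∀ x, ∀ r ∈ R, ⟪x r, g x⟫ = 0 := by
  classical
  let M : (V → E) → Matrix R R ℝ := fun x => Matrix.of fun r s => ⟪x r, x s⟫
  let w : (V → E) → R → ℝ := fun x r => ⟪x r, y a⟫
  let c : (V → E) → R → ℝ := fun x => Matrix.mulVec (M x).adjugate (w x)
  have hM : Continuous M := by
    refine continuous_matrix fun r s => ?_
    simp only [M, Matrix.of_apply]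
    fun_prop
  have hw : Continuous w := by fun_prop
  have hc : Continuous c := hM.matrix_adjugate.matrix_mulVec hw
  have hdet : (M y).det ≠ 0 := by
    have : IsUnit (M y) := Matrix.linearIndependent_cols_iff_isUnit.1 h
    exact ((Matrix.isUnit_iff_isUnit_det _).1 this).ne_zero
  refine ⟨fun x => (M y).det⁻¹ • ((M x).det • y a - ∑ r : R, c x r • x r), ?_, ?_, ?_⟩
  · have hd := hM.matrix_det
    fun_prop
  · have hwy : w y = 0 := by
      ext r
      exact ha r r.2
    simp [c, hwy, smul_smul, inv_mul_cancel₀ hdet]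
  · intro x r hr
    have key : ∑ s : R, c x s * ⟪x r, x s⟫ = (M x).det * ⟪x r, y a⟫ := by
      have : Matrix.mulVec (M x) (c x) = (M x).det • w x := by
        simp only [c, Matrix.mulVec_mulVec, Matrix.mul_adjugate, Matrix.smul_mulVec,
          Matrix.one_mulVec]
      have := congrFun this ⟨r, hr⟩
      simpa [Matrix.mulVec, dotProduct, M, w, mul_comm] using this
    simp only [inner_smul_right, inner_sub_right, inner_sum, key, sub_self, mul_zero]

end CrossIndep

/-- Points of `g + L` arbitrarily close to `g` avoid finitely many subspaces not containing `L`. -/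
theorem exists_mem_nhds_notMem_submodules {E ι : Type*} [NormedAddCommGroup E] [NormedSpace ℝ E]
    [Finite ι] (L : Submodule ℝ E) (K : ι → Submodule ℝ E) (hK : ∀ i, ¬ L ≤ K i) (g : E)
    {N : Set E} (hN : N ∈ nhds g) : ∃ p ∈ N, p - g ∈ L ∧ ∀ i, p ∉ K i := by
  obtain ⟨w, hw⟩ : ∃ w : L, ∀ i, (w : E) ∉ K i := by
    by_contra! hno
    obtain ⟨i, hi⟩ := Subspace.exists_eq_top_of_iUnion_eq_univ
      (p := fun i => (K i).comap L.subtype) (Set.eq_univ_of_forall fun w => by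
        obtain ⟨i, hi⟩ := hno w
        exact Set.mem_iUnion.2 ⟨i, hi⟩)
    exact hK i fun v hv => by
      have : (⟨v, hv⟩ : L) ∈ (K i).comap L.subtype := hi ▸ Submodule.mem_top
      exact this
  have hcont : Continuous fun t : ℝ => g + t • (w : E) := by fun_prop
  have hnhds : (fun t : ℝ => g + t • (w : E)) ⁻¹' N ∈ nhds (0 : ℝ) :=
    hcont.continuousAt.preimage_mem_nhds (by simpa using hN)
  have hbad : (⋃ i, {t : ℝ | g + t • (w : E) ∈ K i}).Finite := by
    refine Set.finite_iUnion fun i => Set.Subsingleton.finite fun t ht t' ht' => ?_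
    by_contra hne
    have hsub := (K i).sub_mem ht ht'
    rw [add_sub_add_left_eq_sub, ← sub_smul] at hsub
    exact hw i (((K i).smul_mem_iff (sub_ne_zero.2 hne)).1 hsub)
  obtain ⟨t, ht, ht'⟩ := (infinite_of_mem_nhds (0 : ℝ) hnhds).exists_notMem_finite hbad
  refine ⟨g + t • (w : E), ht, by simpa using L.smul_mem t w.2, fun i hi => ht' ?_⟩
  exact Set.mem_iUnion.2 ⟨i, hi⟩

/-- If the cross Gram matrix of `S` and `R` has independent columns and `S` spans a proper
subspace, then the orthogonal complement of the span of `R` is not contained in the span of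
`S`. -/
theorem CrossIndep.not_orthogonal_le_span {V E : Type*} [NormedAddCommGroup E]
    [InnerProductSpace ℝ E] [FiniteDimensional ℝ E] {x : V → E} {S S' R : Finset V}
    (h : CrossIndep x S R) (hS : S ⊆ S') (hcard : S'.card < Module.finrank ℝ E) :
    ¬ (Submodule.span ℝ (x '' (R : Set V)))ᗮ ≤ Submodule.span ℝ (x '' (S' : Set V)) := by
  classical
  set A := Submodule.span ℝ (x '' (S' : Set V))
  set B := Submodule.span ℝ (x '' (R : Set V))
  intro hle
  have hA : A ≠ ⊤ := by
    intro htop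
    have h1 : Module.finrank ℝ A ≤ (S'.image x).card := by
      have := finrank_span_finset_le_card (R := ℝ) (S'.image x)
      rwa [Finset.coe_image] at this
    rw [htop, finrank_top] at h1
    have := Finset.card_image_le (s := S') (f := x)
    omega
  obtain ⟨w, hwA, hw⟩ := Submodule.exists_mem_ne_zero_of_ne_bot
    (mt Submodule.orthogonal_eq_bot_iff.1 hA)
  have hwB : w ∈ B := by
    rw [← Submodule.orthogonal_orthogonal B]
    exact Submodule.orthogonal_le hle hwA
  refine hw (h.eq_zero_of_mem_span hwB fun s hs => ?_)
  exact hwA _ (Submodule.subset_span ⟨s, hS hs, rfl⟩)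

theorem eventually_crossIndep_of_levelDense {V E : Type*} [Finite V] [NormedAddCommGroup E]
    [InnerProductSpace ℝ E] {b : V → ℕ} {d : ℕ} {y : V → E}
    (hfull : ∀ S T, LevelDense b S → LevelDense b T → S.card = T.card → S.card ≤ d →
      CrossIndep y S T) :
    ∀ᶠ x in nhds y, ∀ S T, LevelDense b S → LevelDense b T → S.card = T.card →
      S.card ≤ d → CrossIndep x S T := by
  refine Filter.eventually_all.2 fun S => Filter.eventually_all.2 fun T => ?_
  by_cases hST : LevelDense b S ∧ LevelDense b T ∧ S.card = T.card ∧ S.card ≤ d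
  · obtain ⟨h1, h2, h3, h4⟩ := hST
    filter_upwards [(isOpen_setOf_crossIndep S T).mem_nhds (hfull S T h1 h2 h3 h4)]
      with x hx _ _ _ _ using hx
  · exact Filter.Eventually.of_forall fun x h1 h2 h3 h4 => absurd ⟨h1, h2, h3, h4⟩ hST

/-- An orthogonal family for `H` whose level-dense sets of size at most `d` are in general position
can be perturbed, on a down-closed set `P` of vertices of level at most `d`, so that also the
level-dense sets of size `d + 1` become independent. -/
theorem IsLeveling.exists_perturbation {V E : Type*} [Fintype V] {H : SimpleGraph V} {b : V → ℕ}
    (hb : IsLeveling H b) [NormedAddCommGroup E] [InnerProductSpace ℝ E] [FiniteDimensional ℝ E]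
    {d : ℕ} (hd : d < Module.finrank ℝ E) {y : V → E}
    (horth : ∀ u v, H.Adj u v → ⟪y u, y v⟫ = 0)
    (hfull : ∀ S T, LevelDense b S → LevelDense b T → S.card = T.card → S.card ≤ d →
      CrossIndep y S T)
    (P : Finset V) (hP : ∀ v ∈ P, b v ≤ d) (hlower : ∀ v ∈ P, ∀ u, b u < b v → u ∈ P) :
    ∀ U ∈ nhds y, ∃ x ∈ U, (∀ u ∈ P, ∀ v ∈ P, H.Adj u v → ⟪x u, x v⟫ = 0) ∧
      ∀ S ⊆ P, LevelDense b S → S.card = d + 1 → LinearIndepOn ℝ x (S : Set V) := by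
  classical
  induction P using Finset.induction_on_max_value b with
  | empty =>
    refine fun U hU => ⟨y, mem_of_mem_nhds hU, by simp, fun S hS _ hcard => ?_⟩
    rw [Finset.subset_empty.1 hS] at hcard
    simp at hcard
  | insert a P haP hmax ih =>
    have hP' : ∀ v ∈ P, b v ≤ d := fun v hv => hP v (Finset.mem_insert_of_mem hv)
    have hlower' : ∀ v ∈ P, ∀ u, b u < b v → u ∈ P := by
      intro v hv u huv
      refine Finset.mem_of_mem_insert_of_ne (hlower v (Finset.mem_insert_of_mem hv) u huv) ?_
      rintro rfl
      exact absurd (hmax v hv) (not_le.2 huv)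
    intro U hU
    have had : b a ≤ d := hP a (Finset.mem_insert_self a P)
    set R := lowerNeighbors H b a with hR
    have hRcard : R.card = b a := hb.card_lowerNeighbors a
    have hRdense : LevelDense b R := hb.levelDense_lowerNeighbors a
    obtain ⟨g, hg, hgy, hgorth⟩ :=
      (hfull R R hRdense hRdense rfl (hRcard.le.trans had)).exists_continuous_orthogonal
        (a := a) fun r hr => (horth a r (mem_lowerNeighbors.1 hr).1 ▸ real_inner_comm _ _)
    have hupd : Continuous fun x : V → E => Function.update x a (g x) :=
      continuous_id.update a hg
    have hU' : (fun x : V → E => Function.update x a (g x)) ⁻¹' interior U ∈ nhds y := by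
      refine hupd.continuousAt.preimage_mem_nhds ?_
      simpa [hgy] using interior_mem_nhds.2 hU
    obtain ⟨x, ⟨hxU, hxfull⟩, hxorth, hxindep⟩ :=
      ih hP' hlower' _ (Filter.inter_mem hU' (eventually_crossIndep_of_levelDense hfull))
    let L := (Submodule.span ℝ (x '' (R : Set V)))ᗮ
    let ι := {S : Finset V // S ⊆ insert a P ∧ LevelDense b S ∧ S.card = d + 1 ∧ a ∈ S}
    have hdense : ∀ S : ι, LevelDense b (S.1.erase a) ∧ (S.1.erase a).card = d := by
      rintro ⟨S, hS, hSd, hSc, haS⟩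
      refine ⟨hSd.erase haS fun s hs => ?_, by rw [Finset.card_erase_of_mem haS, hSc]; rfl⟩
      rcases Finset.mem_insert.1 (hS hs) with rfl | hs
      · exact le_rfl
      · exact hmax s hs
    have havoid : ∀ S : ι, ¬ L ≤ Submodule.span ℝ (x '' ((S.1.erase a : Finset V) : Set V)) := by
      intro S
      obtain ⟨h1, h2⟩ := hdense S
      obtain ⟨S', hS', hS'd, hS'c⟩ := h1.exists_subset_card_eq (k := R.card) (by omega)
      exact (hxfull S' R hS'd hRdense hS'c (by omega)).not_orthogonal_le_span hS' (by omega)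
    have hN : (fun p => Function.update x a p) ⁻¹' interior U ∈ nhds (g x) :=
      ((continuous_const (y := x)).update a continuous_id).continuousAt.preimage_mem_nhds
        (isOpen_interior.mem_nhds hxU)
    obtain ⟨p, hpN, hpL, hp⟩ := exists_mem_nhds_notMem_submodules L
      (fun S : ι => Submodule.span ℝ (x '' ((S.1.erase a : Finset V) : Set V))) havoid (g x) hN
    have hpR : ∀ r ∈ R, ⟪x r, p⟫ = 0 := by
      intro r hr
      have h1 : ⟪x r, p - g x⟫ = 0 := hpL _ (Submodule.subset_span ⟨r, hr, rfl⟩)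
      rwa [inner_sub_right, hgorth x r hr, sub_zero] at h1
    have hne : ∀ v ∈ P, v ≠ a := fun v hv h => haP (h ▸ hv)
    have hpP : ∀ v ∈ P, H.Adj a v → ⟪x v, p⟫ = 0 := fun v hv hav =>
      hpR v (mem_lowerNeighbors.2
        ⟨hav, lt_of_le_of_ne (hmax v hv) (hb.ne_of_adj a v hav).symm⟩)
    refine ⟨Function.update x a p, interior_subset hpN, ?_, ?_⟩
    · intro u hu v hv huv
      rcases Finset.mem_insert.1 hu with hua | huP <;>
        rcases Finset.mem_insert.1 hv with hva | hvP
      · exact absurd (hua.trans hva.symm) huv.ne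
      · subst hua
        rw [Function.update_self, Function.update_of_ne (hne v hvP), real_inner_comm]
        exact hpP v hvP huv
      · subst hva
        rw [Function.update_self, Function.update_of_ne (hne u huP)]
        exact hpP u huP huv.symm
      · rw [Function.update_of_ne (hne u huP), Function.update_of_ne (hne v hvP)]
        exact hxorth u huP v hvP huv
    · intro S hS hSd hSc
      have heq : ∀ T : Finset V, a ∉ T →
          Set.EqOn x (Function.update x a p) (T : Set V) := fun T hT v hv =>
        (Function.update_of_ne (fun h : v = a => hT (Finset.mem_coe.1 (h ▸ hv))) _ _).symm
      by_cases haS : a ∈ S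
      · obtain ⟨h1, h2⟩ := hdense ⟨S, hS, hSd, hSc, haS⟩
        have hnot : a ∉ S.erase a := Finset.notMem_erase a S
        have hind : LinearIndepOn ℝ x ((S.erase a : Finset V) : Set V) :=
          (hxfull _ _ h1 h1 rfl h2.le).linearIndepOn
        rw [← Finset.insert_erase haS, Finset.coe_insert]
        refine (hind.congr (heq _ hnot)).insert ?_
        rw [← (heq _ hnot).image_eq, Function.update_self]
        exact hp ⟨S, hS, hSd, hSc, haS⟩
      · refine (hxindep S (fun s hs => ?_) hSd hSc).congr (heq S haS)
        exact Finset.mem_of_mem_insert_of_ne (hS hs) fun h => haS (h ▸ hs)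

/-- A leveled graph has, in each dimension `d`, an orthogonal family with all cross Gram matrices
of level-dense sets of equal size at most `d` nonsingular. -/
theorem IsLeveling.exists_crossIndep {V : Type*} [Fintype V] {H : SimpleGraph V} {b : V → ℕ}
    (hb : IsLeveling H b) (d : ℕ) :
    ∃ x : V → EuclideanSpace ℝ (Fin d), (∀ u v, H.Adj u v → ⟪x u, x v⟫ = 0) ∧
      ∀ S T, LevelDense b S → LevelDense b T → S.card = T.card → S.card ≤ d →
        CrossIndep x S T := by
  classical
  induction d with
  | zero =>
    refine ⟨fun _ => 0, by simp, fun S T _ _ hST hS => ?_⟩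
    obtain rfl : T = ∅ := Finset.card_eq_zero.1 (by omega)
    exact linearIndependent_empty_type
  | succ d ih =>
    obtain ⟨x, hx, hxfull⟩ := ih
    let y : V → EuclideanSpace ℝ (Fin (d + 1)) := fun v =>
      if b v < d then WithLp.toLp 2 (Fin.snoc (α := fun _ => ℝ) (x v) 0)
      else if b v = d then EuclideanSpace.single (Fin.last d) 1 else 0
    have hyx : ∀ u v, b u < d → b v < d → ⟪y u, y v⟫ = ⟪x u, x v⟫ := by
      intro u v hu hv
      simp [y, hu, hv, PiLp.inner_apply, Fin.sum_univ_castSucc]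
    have hlast : ∀ u v, b u < d → b v = d → ⟪y u, y v⟫ = 0 := by
      intro u v hu hv
      simp [y, hu, hv, EuclideanSpace.inner_single_right]
    have hy : ∀ u v, H.Adj u v → ⟪y u, y v⟫ = 0 := by
      have hzero : ∀ v, d < b v → y v = 0 := fun v hv => by
        simp [y, hv.not_gt, hv.ne']
      intro u v huv
      rcases lt_trichotomy (b u) d with hu | hu | hu
      · rcases lt_trichotomy (b v) d with hv | hv | hv
        · rw [hyx u v hu hv, hx u v huv]
        · exact hlast u v hu hv
        · rw [hzero v hv, inner_zero_right]
      · rcases lt_trichotomy (b v) d with hv | hv | hv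
        · rw [real_inner_comm, hlast v u hv hu]
        · exact absurd (hu.trans hv.symm) (hb.ne_of_adj u v huv)
        · rw [hzero v hv, inner_zero_right]
      · rw [hzero u hu, inner_zero_left]
    have hyfull : ∀ S T, LevelDense b S → LevelDense b T → S.card = T.card → S.card ≤ d →
        CrossIndep y S T := fun S T hS hT hST hSd =>
      (hxfull S T hS hT hST hSd).congr fun s hs t ht =>
        hyx s t ((hS.lt_card hs).trans_le hSd) ((hT.lt_card ht).trans_le (hST ▸ hSd))
    obtain ⟨z, hzfull, hzorth, hzindep⟩ := hb.exists_perturbation (d := d) (by simp) hy hyfull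
      (Finset.univ.filter fun v => b v ≤ d) (by simp)
      (fun v hv u huv => by simp at hv ⊢; omega) _
      (eventually_crossIndep_of_levelDense hyfull)
    let z' : V → EuclideanSpace ℝ (Fin (d + 1)) := fun v => if b v ≤ d then z v else 0
    have hz' : ∀ v, b v ≤ d → z' v = z v := fun v hv => if_pos hv
    refine ⟨z', fun u v huv => ?_, fun S T hS hT hST hSd => ?_⟩
    · by_cases hu : b u ≤ d
      · by_cases hv : b v ≤ d
        · rw [hz' u hu, hz' v hv]
          exact hzorth u (by simpa using hu) v (by simpa using hv) huv
        · simp [z', hv]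
      · simp [z', hu]
    have hSle : ∀ s ∈ S, b s ≤ d := fun s hs => by have := hS.lt_card hs; omega
    have hTle : ∀ t ∈ T, b t ≤ d := fun t ht => by have := hT.lt_card ht; omega
    refine CrossIndep.congr (x := z) ?_ fun s hs t ht => by rw [hz' s (hSle s hs), hz' t (hTle t ht)]
    rcases hSd.lt_or_eq with hlt | heq
    · exact hzfull S T hS hT hST (by omega)
    have hSi := hzindep S (fun s hs => by simpa using hSle s hs) hS heq
    have hTi := hzindep T (fun t ht => by simpa using hTle t ht) hT (hST ▸ heq)
    refine crossIndep_of_linearIndepOn hTi fun w _ hw => ?_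
    have hspan : Submodule.span ℝ (z '' (S : Set V)) = ⊤ := by
      rw [Set.image_eq_range]
      exact hSi.span_eq_top_of_card_eq_finrank' (by simp [heq])
    have hworth : Submodule.span ℝ (z '' (S : Set V)) ≤ (Submodule.span ℝ {w})ᗮ := by
      refine Submodule.span_le.2 ?_
      rintro _ ⟨s, hs, rfl⟩
      exact Submodule.mem_orthogonal_singleton_iff_inner_left.2 (hw s hs)
    have hmem : w ∈ (Submodule.span ℝ {w})ᗮ := hworth (hspan ▸ Submodule.mem_top)
    exact inner_self_eq_zero.1 (Submodule.mem_orthogonal_singleton_iff_inner_left.1 hmem)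

/-- The complement of a graph with a leveling below `d` has an orthogonal representation in
`ℝ^d`. -/
theorem IsLeveling.hasOrthoRep_compl {V : Type*} [Fintype V] {H : SimpleGraph V} {b : V → ℕ}
    (hb : IsLeveling H b) {d : ℕ} (hd : ∀ v, b v < d) : HasOrthoRep Hᶜ d := by
  classical
  obtain ⟨x, hx, hfull⟩ := hb.exists_crossIndep d
  have key : ∀ u v, b u ≤ b v → u ≠ v → ¬ H.Adj u v → ⟪x u, x v⟫ ≠ 0 := by
    intro u v huv hne hadj h0
    set R := lowerNeighbors H b v with hR
    have hRc : R.card = b v := hb.card_lowerNeighbors v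
    have hRd : LevelDense b R := hb.levelDense_lowerNeighbors v
    have hu : u ∉ R := fun h => hadj (mem_lowerNeighbors.1 h).1.symm
    have hv : v ∉ R := fun h => H.loopless.irrefl v (mem_lowerNeighbors.1 h).1
    have hfull' := hfull (insert u R) (insert v R) (hRd.insert hu (by omega))
      (hRd.insert hv (by omega))
      (by rw [Finset.card_insert_of_notMem hu, Finset.card_insert_of_notMem hv])
      (by rw [Finset.card_insert_of_notMem hu, hRc]; exact hd v)
    refine hfull'.linearIndepOn.ne_zero (Finset.mem_coe.2 (Finset.mem_insert_self v R)) ?_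
    refine hfull'.eq_zero_of_mem_span
      (Submodule.subset_span ⟨v, Finset.mem_coe.2 (Finset.mem_insert_self v R), rfl⟩) ?_
    intro s hs
    rcases Finset.mem_insert.1 hs with rfl | hs
    · exact h0
    · exact hx s v (mem_lowerNeighbors.1 hs).1.symm
  refine ⟨x, fun i j hij => ?_⟩
  rw [SimpleGraph.compl_adj]
  refine ⟨fun h => ⟨hij, fun hadj => h (hx i j hadj)⟩, fun h => ?_⟩
  rcases le_total (b i) (b j) with hle | hle
  · exact key i j hle hij h.2
  · rw [real_inner_comm]
    exact key j i hle hij.symm fun hadj => h.2 hadj.symm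

/-- Every finite graph has an orthogonal representation in dimension one more than the maximum
degree of its complement. -/
theorem hasOrthoRep_maxDegree_compl_add_one {V : Type*} [Fintype V] [DecidableEq V]
    (G : SimpleGraph V) [DecidableRel G.Adj] : HasOrthoRep G (Gᶜ.maxDegree + 1) := by
  obtain ⟨b, hb, hle⟩ := exists_isLeveling Gᶜ
  simpa using hb.hasOrthoRep_compl fun v => Nat.lt_succ_of_le (hle v)

theorem maxDegree_compl_add_one {V : Type*} [Fintype V] [DecidableEq V] [Nonempty V]
    (G : SimpleGraph V) [DecidableRel G.Adj] :
    Gᶜ.maxDegree + 1 = Fintype.card V - G.minDegree := by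
  obtain ⟨u, hu⟩ := G.exists_minimal_degree_vertex
  obtain ⟨v, hv⟩ := Gᶜ.exists_maximal_degree_vertex
  have h1 := Gᶜ.degree_le_maxDegree u
  have h2 := G.minDegree_le_degree v
  have h3 := G.degree_lt_card_verts u
  have h4 := G.degree_lt_card_verts v
  rw [SimpleGraph.degree_compl] at h1 hv
  omega

theorem delta_graph_orthoRep_and_msr {V : Type*} [Fintype V] [DecidableEq V]
    (G : SimpleGraph V) [DecidableRel G.Adj] (hG : IsDeltaGraph G) :
    HasOrthoRep G (Gᶜ.maxDegree + 1) ∧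
    msr G ≤ Gᶜ.maxDegree + 1 ∧
    Gᶜ.maxDegree + 1 = Fintype.card V - G.minDegree := by
  have : Nonempty V := by
    obtain ⟨n, v, hn, -⟩ := hG
    exact ⟨v ⟨0, by omega⟩⟩
  exact ⟨hasOrthoRep_maxDegree_compl_add_one G, Nat.sInf_le (hasOrthoRep_maxDegree_compl_add_one G),
    maxDegree_compl_add_one G⟩
end

section
/- Let G be a simple connected graph with |G| ≥ 4 and let G' = P_n ⊔ G be the disjoint union of G with a path on n = 2Δ(G) + 2 vertices (an extended C-δ graph). Then the complement of G' has an orthogonal representation in ℝ^{Δ(G)+1}. -/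
open SimpleGraph
open scoped RealInnerProductSpace

/-- `A.clearedPerp x` is `det (A * Aᵀ)` times the orthogonal projection of `x` to the kernel
of `A`, written without division. -/
def Matrix.clearedPerp {m n R : Type*} [Fintype m] [DecidableEq m] [Fintype n] [CommRing R]
    (A : Matrix m n R) (x : n → R) : n → R :=
  (A * A.transpose).det • x - A.transpose.mulVec ((A * A.transpose).adjugate.mulVec (A.mulVec x))

section ClearedPerp

variable {m n R S : Type*} [Fintype m] [DecidableEq m] [Fintype n] [CommRing R] [CommRing S]

theorem Matrix.mulVec_clearedPerp (A : Matrix m n R) (x : n → R) :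
    A.mulVec (A.clearedPerp x) = 0 := by
  rw [Matrix.clearedPerp, Matrix.mulVec_sub, Matrix.mulVec_smul, Matrix.mulVec_mulVec,
    Matrix.mulVec_mulVec, Matrix.mul_adjugate, Matrix.smul_mulVec, Matrix.one_mulVec, sub_self]

theorem Matrix.clearedPerp_of_mulVec_eq_zero {A : Matrix m n R} {x : n → R}
    (h : A.mulVec x = 0) : A.clearedPerp x = (A * A.transpose).det • x := by
  rw [Matrix.clearedPerp, h, Matrix.mulVec_zero, Matrix.mulVec_zero, sub_zero]

theorem Matrix.map_clearedPerp (φ : R →+* S) (A : Matrix m n R) (x : n → R) (k : n) :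
    φ (A.clearedPerp x k) = (A.map φ).clearedPerp (fun j => φ (x j)) k := by
  have hadj : ((A * A.transpose).adjugate).map φ =
      ((A.map φ) * (A.map φ).transpose).adjugate := by
    rw [← Matrix.transpose_map, ← Matrix.map_mul]
    exact φ.map_adjugate _
  have hdet : φ (A * A.transpose).det = ((A.map φ) * (A.map φ).transpose).det := by
    rw [← Matrix.transpose_map, ← Matrix.map_mul]
    exact φ.map_det _
  have hx : (fun j => φ (A.mulVec x j)) = (A.map φ).mulVec (fun j => φ (x j)) := by
    funext j
    exact RingHom.map_mulVec φ A x j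
  have hy : (fun j => φ ((A * A.transpose).adjugate.mulVec (A.mulVec x) j)) =
      ((A.map φ) * (A.map φ).transpose).adjugate.mulVec ((A.map φ).mulVec (fun j => φ (x j))) := by
    funext j
    rw [RingHom.map_mulVec, hadj]
    exact congrArg (fun z => Matrix.mulVec _ z j) hx
  simp only [Matrix.clearedPerp, Pi.sub_apply, Pi.smul_apply, smul_eq_mul, map_sub, map_mul, hdet]
  congr 1
  rw [RingHom.map_mulVec, Matrix.transpose_map]
  exact congrArg (fun z => Matrix.mulVec _ z k) hy

end ClearedPerp

theorem Matrix.det_mul_transpose_ne_zero_iff {m n : Type*} [Fintype m] [DecidableEq m] [Fintype n]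
    (A : Matrix m n ℝ) : (A * A.transpose).det ≠ 0 ↔ LinearIndependent ℝ A.row := by
  rw [← isUnit_iff_ne_zero, ← Matrix.isUnit_iff_isUnit_det, ← Matrix.linearIndependent_rows_iff_isUnit,
    linearIndependent_iff_card_eq_finrank_span, linearIndependent_iff_card_eq_finrank_span,
    Set.finrank, Set.finrank, ← Matrix.rank_eq_finrank_span_row, ← Matrix.rank_eq_finrank_span_row,
    Matrix.rank_self_mul_transpose]

section GenericCondition

open Polynomial

/-- A condition on vector configurations that is invariant under nonzero scalings of the vectors
and that, along each polynomial curve of configurations, is the nonvanishing of a polynomial. -/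
structure IsGenericCondition {d : ℕ} (Φ : (ℕ → Fin d → ℝ) → Prop) : Prop where
  smul : ∀ (f : ℕ → Fin d → ℝ) (c : ℕ → ℝ), (∀ i, c i ≠ 0) → Φ f → Φ (fun i => c i • f i)
  poly : ∀ p : ℕ → Fin d → ℝ[X], ∃ P : ℝ[X], ∀ t, P.eval t ≠ 0 ↔ Φ (fun i k => (p i k).eval t)

namespace IsGenericCondition

variable {d : ℕ}

theorem true : IsGenericCondition (d := d) (fun _ => True) :=
  ⟨fun _ _ _ h => h, fun _ => ⟨1, by simp⟩⟩

theorem and {Φ Ψ : (ℕ → Fin d → ℝ) → Prop} (hΦ : IsGenericCondition Φ)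
    (hΨ : IsGenericCondition Ψ) : IsGenericCondition (fun f => Φ f ∧ Ψ f) := by
  refine ⟨fun f c hc h => ⟨hΦ.smul f c hc h.1, hΨ.smul f c hc h.2⟩, fun p => ?_⟩
  obtain ⟨P, hP⟩ := hΦ.poly p
  obtain ⟨Q, hQ⟩ := hΨ.poly p
  exact ⟨P * Q, fun t => by rw [eval_mul, mul_ne_zero_iff, hP, hQ]⟩

theorem imp (a : Prop) {Φ : (ℕ → Fin d → ℝ) → Prop} (hΦ : IsGenericCondition Φ) :
    IsGenericCondition (fun f => a → Φ f) := by
  by_cases ha : a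
  · simpa [ha] using hΦ
  · simpa [ha] using IsGenericCondition.true

theorem forall_mem {ι : Type*} (s : Finset ι) {Φ : ι → (ℕ → Fin d → ℝ) → Prop}
    (hΦ : ∀ i ∈ s, IsGenericCondition (Φ i)) : IsGenericCondition (fun f => ∀ i ∈ s, Φ i f) := by
  classical
  induction s using Finset.induction_on with
  | empty => simpa using IsGenericCondition.true
  | insert a s _ ih =>
    simp only [Finset.forall_mem_insert] at hΦ ⊢
    exact hΦ.1.and (ih hΦ.2)

theorem dotProduct_ne_zero (i j : ℕ) :
    IsGenericCondition (d := d) (fun f => f i ⬝ᵥ f j ≠ 0) := by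
  refine ⟨fun f c hc h => ?_, fun p => ⟨p i ⬝ᵥ p j, fun t => ?_⟩⟩
  · simpa [hc i, hc j] using h
  · simp [dotProduct, eval_finsetSum]

theorem linearIndepOn (s : Finset ℕ) :
    IsGenericCondition (d := d) (fun f => LinearIndepOn ℝ f (s : Set ℕ)) := by
  refine ⟨fun f c hc h => ?_, fun p => ?_⟩
  · exact LinearIndependent.units_smul h (fun i => Units.mk0 (c i) (hc i))
  · let A : Matrix s (Fin d) ℝ[X] := Matrix.of fun a => p a
    refine ⟨(A * A.transpose).det, fun t => ?_⟩
    have h := Matrix.det_mul_transpose_ne_zero_iff (A.map (evalRingHom t))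
    rw [← Matrix.transpose_map, ← Matrix.map_mul] at h
    have h' : eval t (A * A.transpose).det = ((A * A.transpose).map (evalRingHom t)).det :=
      (evalRingHom t).map_det _
    rw [h']
    exact h

end IsGenericCondition

end GenericCondition

section PrefixRepresentation

open Finset Polynomial

variable {adj : ℕ → ℕ → Prop}

open Classical in
/-- The neighbours of `i` that precede `i`. -/
noncomputable def backNbrs (adj : ℕ → ℕ → Prop) (i : ℕ) : Finset ℕ := {j ∈ range i | adj i j}

theorem mem_backNbrs {i j : ℕ} : j ∈ backNbrs adj i ↔ j < i ∧ adj i j := by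
  simp [backNbrs]

/-- The first `n` vectors of `f` turn adjacency into orthogonality, and each of the first `n`
vertices has linearly independent preceding neighbours. -/
structure IsNondegenerate (adj : ℕ → ℕ → Prop) (n : ℕ) {d : ℕ} (f : ℕ → Fin d → ℝ) : Prop where
  orth : ∀ i < n, ∀ j ∈ backNbrs adj i, f j ⬝ᵥ f i = 0
  indep : ∀ i < n, LinearIndepOn ℝ f (backNbrs adj i : Set ℕ)

theorem IsNondegenerate.mono {n m d : ℕ} {f : ℕ → Fin d → ℝ} (h : IsNondegenerate adj n f)
    (hm : m ≤ n) : IsNondegenerate adj m f :=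
  ⟨fun i hi => h.orth i (hi.trans_le hm), fun i hi => h.indep i (hi.trans_le hm)⟩

/-- Two nondegenerate configurations are joined, up to scaling of the vectors, by a polynomial
curve of configurations turning adjacency into orthogonality. -/
theorem IsNondegenerate.exists_curve {d : ℕ} {f g : ℕ → Fin d → ℝ} (n : ℕ)
    (hf : IsNondegenerate adj n f) (hg : IsNondegenerate adj n g) :
    ∃ (p : ℕ → Fin d → ℝ[X]) (a b : ℕ → ℝ), (∀ i, a i ≠ 0) ∧ (∀ i, b i ≠ 0) ∧
      (∀ i < n, ∀ j ∈ backNbrs adj i, p j ⬝ᵥ p i = 0) ∧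
      (∀ i k, (p i k).eval 0 = a i * f i k) ∧ (∀ i k, (p i k).eval 1 = b i * g i k) := by
  induction n with
  | zero =>
    exact ⟨fun i k => (1 - X) * C (f i k) + X * C (g i k), 1, 1, by simp, by simp, by simp,
      by simp, by simp⟩
  | succ n ih =>
    obtain ⟨p, a, b, ha, hb, hp, hpa, hpb⟩ := ih (hf.mono n.le_succ) (hg.mono n.le_succ)
    let A : Matrix (backNbrs adj n) (Fin d) ℝ[X] := Matrix.of fun j => p j
    let x : Fin d → ℝ[X] := fun k => (1 - X) * C (f n k) + X * C (g n k)
    have key : ∀ (t : ℝ) (h : ℕ → Fin d → ℝ) (c : ℕ → ℝ), IsNondegenerate adj (n + 1) h →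
        (∀ i, c i ≠ 0) → (∀ i k, (p i k).eval t = c i * h i k) → (∀ k, (x k).eval t = h n k) →
        ∃ e : ℝ, e ≠ 0 ∧ ∀ k, (A.clearedPerp x k).eval t = e * h n k := by
      intro t h c hh hc hpc hx
      have hA : A.map (evalRingHom t) = Matrix.of fun (j : backNbrs adj n) k => c j * h j k := by
        ext j k
        exact hpc j k
      have hx' : (fun k => evalRingHom t (x k)) = h n := funext hx
      refine ⟨(A.map (evalRingHom t) * (A.map (evalRingHom t)).transpose).det, ?_, fun k => ?_⟩
      · rw [Matrix.det_mul_transpose_ne_zero_iff, hA]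
        exact LinearIndependent.units_smul (hh.indep n n.lt_succ_self)
          (fun i => Units.mk0 (c i) (hc i))
      · have := Matrix.map_clearedPerp (evalRingHom t) A x k
        rw [coe_evalRingHom] at this
        rw [this, ← coe_evalRingHom, hx', Matrix.clearedPerp_of_mulVec_eq_zero, Pi.smul_apply,
          smul_eq_mul]
        rw [hA]
        funext j
        have h0 := hh.orth n n.lt_succ_self j j.2
        simp only [dotProduct] at h0
        simp [Matrix.mulVec, dotProduct, mul_assoc, ← Finset.mul_sum, h0]
    obtain ⟨e₀, he₀, h₀⟩ := key 0 f a hf ha hpa (by simp [x])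
    obtain ⟨e₁, he₁, h₁⟩ := key 1 g b hg hb hpb (by simp [x])
    refine ⟨Function.update p n (A.clearedPerp x), Function.update a n e₀,
      Function.update b n e₁, ?_, ?_, ?_, ?_, ?_⟩
    · intro i
      by_cases hi : i = n
      · subst hi; simpa
      · simpa [hi] using ha i
    · intro i
      by_cases hi : i = n
      · subst hi; simpa
      · simpa [hi] using hb i
    · intro i hi j hj
      have hji := (mem_backNbrs.1 hj).1
      have hjn : j ≠ n := by omega
      by_cases hin : i = n
      · subst hin
        rw [Function.update_of_ne hjn, Function.update_self]
        exact congrFun (A.mulVec_clearedPerp x) ⟨j, hj⟩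
      · simpa [hjn, hin] using hp i (by omega) j hj
    · intro i k
      by_cases hi : i = n
      · subst hi; simpa using h₀ k
      · simpa [hi] using hpa i k
    · intro i k
      by_cases hi : i = n
      · subst hi; simpa using h₁ k
      · simpa [hi] using hpb i k

theorem IsNondegenerate.exists_and {n d : ℕ} {Φ Ψ : (ℕ → Fin d → ℝ) → Prop}
    (hΦ : IsGenericCondition Φ) (hΨ : IsGenericCondition Ψ)
    (h₁ : ∃ f, IsNondegenerate adj n f ∧ Φ f) (h₂ : ∃ f, IsNondegenerate adj n f ∧ Ψ f) :
    ∃ f, IsNondegenerate adj n f ∧ Φ f ∧ Ψ f := by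
  obtain ⟨f, hf, hfΦ⟩ := h₁
  obtain ⟨g, hg, hgΨ⟩ := h₂
  obtain ⟨p, a, b, ha, hb, hp, hpa, hpb⟩ := hf.exists_curve n hg
  have hI : IsGenericCondition (d := d)
      (fun f => ∀ i ∈ range n, LinearIndepOn ℝ f (backNbrs adj i : Set ℕ)) :=
    .forall_mem _ fun i _ => .linearIndepOn _
  have h0 : (fun i k => (p i k).eval 0) = fun i => a i • f i := by
    funext i k; exact hpa i k
  have h1 : (fun i k => (p i k).eval 1) = fun i => b i • g i := by
    funext i k; exact hpb i k
  obtain ⟨P, hP⟩ := (hI.and hΦ).poly p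
  obtain ⟨Q, hQ⟩ := hΨ.poly p
  have hP0 : P ≠ 0 := by
    rintro rfl
    refine (hP 0).2 ?_ eval_zero
    rw [h0]
    exact (hI.and hΦ).smul f a ha ⟨fun i hi => hf.indep i (mem_range.1 hi), hfΦ⟩
  have hQ0 : Q ≠ 0 := by
    rintro rfl
    refine (hQ 1).2 ?_ eval_zero
    rw [h1]
    exact hΨ.smul g b hb hgΨ
  obtain ⟨t, ht⟩ := Polynomial.exists_eval_ne_zero_of_natDegree_lt_card (P * Q)
    (mul_ne_zero hP0 hQ0) (by
      rw [Cardinal.mk_real]; exact (Cardinal.natCast_lt_aleph0).trans Cardinal.aleph0_lt_continuum)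
  rw [eval_mul, mul_ne_zero_iff, hP, hQ] at ht
  refine ⟨_, ⟨fun i hi j hj => ?_, fun i hi => ht.1.1 i (mem_range.2 hi)⟩, ht.1.2, ht.2⟩
  have := congrArg (eval t) (hp i hi j hj)
  simpa [dotProduct, eval_finsetSum] using this

theorem IsNondegenerate.exists_forall_mem {ι : Type*} {n d : ℕ} (s : Finset ι)
    {Φ : ι → (ℕ → Fin d → ℝ) → Prop} (hΦ : ∀ i ∈ s, IsGenericCondition (Φ i))
    (h₀ : ∃ f : ℕ → Fin d → ℝ, IsNondegenerate adj n f)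
    (h : ∀ i ∈ s, ∃ f, IsNondegenerate adj n f ∧ Φ i f) :
    ∃ f, IsNondegenerate adj n f ∧ ∀ i ∈ s, Φ i f := by
  classical
  induction s using Finset.induction_on with
  | empty => simpa using h₀
  | insert a s _ ih =>
    simp only [Finset.forall_mem_insert] at hΦ h ⊢
    exact exists_and hΦ.1 (.forall_mem s hΦ.2) h.1 (ih hΦ.2 h.2)

theorem LinearIndepOn.update_of_notMem {d n : ℕ} {f : ℕ → Fin d → ℝ} {s : Set ℕ}
    (h : LinearIndepOn ℝ f s) (hn : n ∉ s) (x : Fin d → ℝ) :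
    LinearIndepOn ℝ (Function.update f n x) s :=
  h.congr fun i hi => by rw [Function.update_of_ne (by rintro rfl; exact hn hi)]

theorem IsNondegenerate.update {n d : ℕ} {f : ℕ → Fin d → ℝ} (hf : IsNondegenerate adj n f)
    (hn : LinearIndepOn ℝ f (backNbrs adj n : Set ℕ)) {x : Fin d → ℝ}
    (hx : ∀ j ∈ backNbrs adj n, f j ⬝ᵥ x = 0) :
    IsNondegenerate adj (n + 1) (Function.update f n x) := by
  refine ⟨fun i hi j hj => ?_, fun i hi => ?_⟩
  · have hji := (mem_backNbrs.1 hj).1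
    have hjn : j ≠ n := by omega
    by_cases hin : i = n
    · subst hin
      simpa [hjn] using hx j hj
    · simpa [hjn, hin] using hf.orth i (by omega) j hj
  · refine LinearIndepOn.update_of_notMem ?_ (fun h => ?_) x
    · rcases Nat.lt_succ_iff_lt_or_eq.1 hi with hi | rfl
      · exact hf.indep i hi
      · exact hn
    · have := (mem_backNbrs.1 (mem_coe.1 h)).1
      omega

/-- A set of vertices that could serve as the preceding neighbours of a new vertex `n` when
the vertices are ordered by always taking one with the fewest preceding neighbours. -/
structure IsAdmissible (adj : ℕ → ℕ → Prop) (n : ℕ) (T : Finset ℕ) : Prop where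
  subset : T ⊆ range n
  card_le : ∀ i < n, #(backNbrs adj i) ≤ #{k ∈ T | k < i}

theorem IsAdmissible.of_notMem {n : ℕ} {T : Finset ℕ} (h : IsAdmissible adj (n + 1) T)
    (hn : n ∉ T) : IsAdmissible adj n T := by
  refine ⟨fun k hk => ?_, fun i hi => h.card_le i (by omega)⟩
  have := mem_range.1 (h.subset hk)
  have hkn : k ≠ n := by rintro rfl; exact hn hk
  exact mem_range.2 (by omega)

theorem IsAdmissible.erase {n : ℕ} {T : Finset ℕ} (h : IsAdmissible adj (n + 1) T) :
    IsAdmissible adj n (T.erase n) := by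
  refine ⟨fun k hk => ?_, fun i hi => (h.card_le i (by omega)).trans (card_le_card fun k hk => ?_)⟩
  · have := mem_range.1 (h.subset (mem_of_mem_erase hk))
    have hkn := ne_of_mem_erase hk
    exact mem_range.2 (by omega)
  · obtain ⟨hk, hki⟩ := mem_filter.1 hk
    exact mem_filter.2 ⟨mem_erase.2 ⟨by omega, hk⟩, hki⟩

theorem IsAdmissible.card_backNbrs_le {n : ℕ} {T : Finset ℕ} (h : IsAdmissible adj (n + 1) T) :
    #(backNbrs adj n) ≤ #(T.erase n) := by
  refine (h.card_le n n.lt_succ_self).trans (card_le_card fun k hk => ?_)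
  obtain ⟨hk, hki⟩ := mem_filter.1 hk
  exact mem_erase.2 ⟨by omega, hk⟩

theorem IsAdmissible.insert {n u : ℕ} {T : Finset ℕ} (h : IsAdmissible adj n T) (hu : u < n) :
    IsAdmissible adj n (insert u T) :=
  ⟨insert_subset (mem_range.2 hu) h.subset,
    fun i hi => (h.card_le i hi).trans (card_le_card (filter_subset_filter _ (subset_insert u T)))⟩

/-- Each of the first `N` vertices has at most as many neighbours preceding it as any later one
has among the same vertices. -/
def IsMinCardinalityOrder (adj : ℕ → ℕ → Prop) (N : ℕ) : Prop :=
  ∀ i j, i ≤ j → j < N → #(backNbrs adj i) ≤ #{k ∈ backNbrs adj j | k < i}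

theorem IsMinCardinalityOrder.isAdmissible_backNbrs {N n : ℕ} (h : IsMinCardinalityOrder adj N)
    (hn : n < N) : IsAdmissible adj n (backNbrs adj n) :=
  ⟨fun _ hk => mem_range.2 (mem_backNbrs.1 hk).1, fun i hi => h i n hi.le hn⟩

theorem IsMinCardinalityOrder.card_backNbrs_mono {N i j : ℕ} (h : IsMinCardinalityOrder adj N)
    (hij : i ≤ j) (hj : j < N) : #(backNbrs adj i) ≤ #(backNbrs adj j) :=
  (h i j hij hj).trans (card_le_card (filter_subset _ _))

theorem exists_dotProduct_ne_zero_of_notMem_span {ι : Type*} {d : ℕ} {f : ι → Fin d → ℝ}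
    {s : Set ι} {u : Fin d → ℝ} (hu : u ∉ Submodule.span ℝ (f '' s)) :
    ∃ x : Fin d → ℝ, (∀ j ∈ s, f j ⬝ᵥ x = 0) ∧ u ⬝ᵥ x ≠ 0 := by
  obtain ⟨φ, hφu, hφ⟩ := Submodule.exists_le_ker_of_notMem hu
  have h : ∀ v, v ⬝ᵥ (fun k => φ (Pi.single k 1)) = φ v := fun v => by
    conv_rhs => rw [pi_eq_sum_univ' v, map_sum]
    simp [dotProduct]
  refine ⟨fun k => φ (Pi.single k 1), fun j hj => ?_, ?_⟩
  · rw [h]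
    exact hφ (Submodule.subset_span ⟨j, hj, rfl⟩)
  · rwa [h]

/-- Placing a configuration in a hyperplane and a further vector on the normal line. -/
theorem IsNondegenerate.exists_linearIndepOn_insert {n d : ℕ} {g : ℕ → Fin d → ℝ}
    (hg : IsNondegenerate adj n g) (hn : LinearIndepOn ℝ g (backNbrs adj n : Set ℕ))
    {T : Finset ℕ} (hT : LinearIndepOn ℝ g (T : Set ℕ)) (hnT : n ∉ T) :
    ∃ f : ℕ → Fin (d + 1) → ℝ, IsNondegenerate adj (n + 1) f ∧
      LinearIndepOn ℝ f (insert n T : Set ℕ) := by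
  let L : (Fin d → ℝ) →ₗ[ℝ] (Fin (d + 1) → ℝ) :=
    { toFun := fun v => Matrix.vecCons 0 v
      map_add' := fun v w => by simp
      map_smul' := fun c v => by simp }
  have hL : LinearMap.ker L = ⊥ := LinearMap.ker_eq_bot'.2 fun v hv => by
    funext k
    exact congrFun hv k.succ
  have hLi : ∀ s : Set ℕ, LinearIndepOn ℝ g s → LinearIndepOn ℝ (fun i => L (g i)) s :=
    fun s hs => LinearIndependent.map' hs L hL
  have hLg : IsNondegenerate adj n (fun i => L (g i)) :=
    ⟨fun i hi j hj => by simpa [L] using hg.orth i hi j hj, fun i hi => hLi _ (hg.indep i hi)⟩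
  have hnT' : n ∉ (T : Set ℕ) := mem_coe.not.2 hnT
  refine ⟨_, hLg.update (hLi _ hn) (x := Matrix.vecCons 1 0) fun j _ => by simp [L], ?_⟩
  rw [linearIndepOn_insert hnT']
  refine ⟨(hLi _ hT).update_of_notMem hnT' _, fun hmem => ?_⟩
  have hle : Submodule.span ℝ (Function.update (fun i => L (g i)) n (Matrix.vecCons 1 0) '' (T : Set ℕ)) ≤
      LinearMap.ker (LinearMap.proj (0 : Fin (d + 1))) := by
    rw [Submodule.span_le]
    rintro _ ⟨i, hi, rfl⟩
    have hin : i ≠ n := by rintro rfl; exact hnT' hi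
    simp [hin, L]
  simpa using hle hmem

/-- In `ℝ^d`, the vertices of a minimum cardinality order admit a nondegenerate configuration in
which admissible sets of size at most `d` are independent and nonadjacent vertices are not
orthogonal. -/
theorem IsMinCardinalityOrder.exists_isNondegenerate {N : ℕ} (hN : IsMinCardinalityOrder adj N)
    (n : ℕ) (hnN : n ≤ N) (d : ℕ) (hd : ∀ i < n, #(backNbrs adj i) ≤ d) :
    ∃ f : ℕ → Fin d → ℝ, IsNondegenerate adj n f ∧
      (∀ T ∈ (range n).powerset, IsAdmissible adj n T → #T ≤ d →
        LinearIndepOn ℝ f (T : Set ℕ)) ∧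
      ∀ v ∈ range n, ∀ u ∈ range v, ¬ adj v u → #(backNbrs adj v) < d → f u ⬝ᵥ f v ≠ 0 := by
  induction n generalizing d with
  | zero =>
    refine ⟨0, ⟨by simp, by simp⟩, fun T hT _ _ => ?_, by simp⟩
    obtain rfl : T = ∅ := by simpa using hT
    simp
  | succ n ih =>
    have hadm := hN.isAdmissible_backNbrs (n := n) hnN
    obtain ⟨f₀, hf₀, hf₀T, hf₀p⟩ := ih (by omega) d fun i hi => hd i (by omega)
    have hf₀n : LinearIndepOn ℝ f₀ (backNbrs adj n : Set ℕ) :=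
      hf₀T _ (mem_powerset.2 hadm.subset) hadm (hd n n.lt_succ_self)
    have hf₀u : IsNondegenerate adj (n + 1) (Function.update f₀ n 0) :=
      hf₀.update hf₀n fun _ _ => dotProduct_zero _
    refine IsNondegenerate.exists_and
      (.forall_mem _ fun T _ => .imp _ (.imp _ (.linearIndepOn T)))
      (.forall_mem _ fun v _ => .forall_mem _ fun u _ => .imp _ (.imp _ (.dotProduct_ne_zero u v)))
      ?_ ?_
    · refine IsNondegenerate.exists_forall_mem _
        (fun T _ => .imp _ (.imp _ (.linearIndepOn T))) ⟨_, hf₀u⟩ fun T _ => ?_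
      by_cases hT : IsAdmissible adj (n + 1) T ∧ #T ≤ d
      swap
      · exact ⟨_, hf₀u, fun h₁ h₂ => (hT ⟨h₁, h₂⟩).elim⟩
      obtain ⟨hTa, hTd⟩ := hT
      by_cases hnT : n ∈ T
      · have hcard := card_erase_add_one hnT
        obtain ⟨d, rfl⟩ : ∃ e, d = e + 1 := ⟨d - 1, by omega⟩
        have hbd : #(backNbrs adj n) ≤ d := hTa.card_backNbrs_le.trans (by omega)
        obtain ⟨g, hg, hgT, -⟩ := ih (by omega) d fun i hi =>
          (hN.card_backNbrs_mono hi.le hnN).trans hbd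
        obtain ⟨f, hf, hfT⟩ := hg.exists_linearIndepOn_insert
          (hgT _ (mem_powerset.2 hadm.subset) hadm hbd)
          (hgT _ (mem_powerset.2 hTa.erase.subset) hTa.erase (by omega)) (notMem_erase n T)
        refine ⟨f, hf, fun _ _ => ?_⟩
        rwa [← coe_insert, insert_erase hnT] at hfT
      · have hTn := hTa.of_notMem hnT
        exact ⟨_, hf₀u, fun _ _ => (hf₀T T (mem_powerset.2 hTn.subset) hTn hTd).update_of_notMem
          (mem_coe.not.2 hnT) _⟩
    · refine IsNondegenerate.exists_forall_mem _
        (fun v _ => .forall_mem _ fun u _ => .imp _ (.imp _ (.dotProduct_ne_zero u v)))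
        ⟨_, hf₀u⟩ fun v hv => ?_
      refine IsNondegenerate.exists_forall_mem _
        (fun u _ => .imp _ (.imp _ (.dotProduct_ne_zero u v))) ⟨_, hf₀u⟩ fun u hu => ?_
      rw [mem_range] at hu hv
      rcases Nat.lt_succ_iff_lt_or_eq.1 hv with hvn | rfl
      · refine ⟨_, hf₀u, fun h₁ h₂ => ?_⟩
        rw [Function.update_of_ne (by omega), Function.update_of_ne (by omega)]
        exact hf₀p v (mem_range.2 hvn) u (mem_range.2 hu) h₁ h₂
      · by_cases h : ¬ adj v u ∧ #(backNbrs adj v) < d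
        swap
        · exact ⟨_, hf₀u, fun h₁ h₂ => (h ⟨h₁, h₂⟩).elim⟩
        have huv : u ∉ backNbrs adj v := fun h' => h.1 (mem_backNbrs.1 h').2
        have hins := hf₀T _ (mem_powerset.2 (hadm.insert hu).subset) (hadm.insert hu)
          ((card_insert_le _ _).trans h.2)
        rw [coe_insert, linearIndepOn_insert (mem_coe.not.2 huv)] at hins
        obtain ⟨x, hx, hxu⟩ := exists_dotProduct_ne_zero_of_notMem_span hins.2
        refine ⟨_, hf₀.update hf₀n hx, fun _ _ => ?_⟩
        rwa [Function.update_of_ne (by omega), Function.update_self]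

end PrefixRepresentation

section MinCardinalityOrder

open Finset

variable {W : Type*} [Fintype W]

/-- Every finite graph has a vertex enumeration that always takes a vertex with the fewest
neighbours among the preceding ones. -/
theorem SimpleGraph.exists_isMinCardinalityOrder [Nonempty W] (H : SimpleGraph W) :
    ∃ a : ℕ → W, Set.BijOn a (range (Fintype.card W)) Set.univ ∧
      IsMinCardinalityOrder (fun i j => H.Adj (a i) (a j)) (Fintype.card W) := by
  classical
  have hnext : ∀ S : Finset W, ∃ w, S ≠ univ → w ∉ S ∧
      ∀ v ∉ S, #{x ∈ S | H.Adj w x} ≤ #{x ∈ S | H.Adj v x} := by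
    intro S
    by_cases hS : S = univ
    · exact ⟨Classical.arbitrary W, fun h => (h hS).elim⟩
    · have hne : Sᶜ.Nonempty := by
        rwa [nonempty_iff_ne_empty, Ne, compl_eq_empty_iff]
      obtain ⟨w, hw, hmin⟩ := exists_min_image Sᶜ (fun v => #{x ∈ S | H.Adj v x}) hne
      exact ⟨w, fun _ => ⟨mem_compl.1 hw, fun v hv => hmin v (mem_compl.2 hv)⟩⟩
  choose next hnext using hnext
  let S : ℕ → Finset W := fun k => Nat.rec ∅ (fun _ T => insert (next T) T) k
  let a : ℕ → W := fun k => next (S k)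
  have hS : ∀ k, S k = (range k).image a := by
    intro k
    induction k with
    | zero => simp [S]
    | succ k ih => rw [range_add_one, image_insert, ← ih]
  have hSne : ∀ k < Fintype.card W, S k ≠ univ := by
    intro k hk h
    have := card_image_le (s := range k) (f := a)
    rw [← hS, h, card_univ, card_range] at this
    omega
  have hnot : ∀ i j, i ≤ j → j < Fintype.card W → a j ∉ S i := by
    intro i j hij hj h
    refine (hnext (S j) (hSne j hj)).1 ?_
    change a j ∈ S j
    rw [hS] at h ⊢
    exact image_subset_image (range_subset_range.2 hij) h
  have hinj : Set.InjOn a (range (Fintype.card W)) := by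
    have aux : ∀ i j, i < j → j < Fintype.card W → a i ≠ a j := by
      intro i j hij hj h
      refine hnot j j le_rfl hj ?_
      rw [hS, ← h]
      exact mem_image_of_mem a (mem_range.2 hij)
    intro i hi j hj h
    rw [mem_coe, mem_range] at hi hj
    by_contra hne
    rcases lt_or_gt_of_ne hne with h' | h'
    · exact aux i j h' hj h
    · exact aux j i h' hi h.symm
  refine ⟨a, ⟨fun _ _ => Set.mem_univ _, hinj, ?_⟩, fun i j hij hj => ?_⟩
  · have : (range (Fintype.card W)).image a = univ := by
      rw [← card_eq_iff_eq_univ, card_image_of_injOn hinj, card_range]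
    intro w _
    rw [← coe_image, this]
    exact mem_univ w
  · have hcount : ∀ v, #{x ∈ S i | H.Adj v x} = #{k ∈ range i | H.Adj v (a k)} := by
      intro v
      rw [hS, filter_image, card_image_of_injOn]
      refine hinj.mono fun k hk => ?_
      have := (mem_filter.1 (mem_coe.1 hk)).1
      exact mem_coe.2 (mem_range.2 ((mem_range.1 this).trans_le (hij.trans hj.le)))
    have h := (hnext (S i) (hSne i (hij.trans_lt hj))).2 (a j) (hnot i j hij hj)
    change #{x ∈ S i | H.Adj (a i) x} ≤ _ at h
    rw [hcount, hcount] at h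
    refine (card_le_card fun k hk => ?_).trans (h.trans (card_le_card fun k hk => ?_))
    · rw [mem_backNbrs] at hk
      exact mem_filter.2 ⟨mem_range.2 hk.1, hk.2⟩
    · rw [mem_filter, mem_range] at hk
      exact mem_filter.2 ⟨mem_backNbrs.2 ⟨hk.1.trans_le hij, hk.2⟩, hk.1⟩

/-- If all degrees of a finite graph are at most `D`, its complement has an orthogonal
representation in `ℝ^(D+1)`. -/
theorem hasOrthoRep_compl_of_degree_le (H : SimpleGraph W) [DecidableRel H.Adj] {D : ℕ}
    (hD : ∀ v, H.degree v ≤ D) : HasOrthoRep Hᶜ (D + 1) := by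
  classical
  rcases isEmpty_or_nonempty W with hW | hW
  · exact ⟨fun w => (hW.false w).elim, fun w => (hW.false w).elim⟩
  obtain ⟨a, ha, hord⟩ := H.exists_isMinCardinalityOrder
  have hback : ∀ i < Fintype.card W, #(backNbrs (fun i j => H.Adj (a i) (a j)) i) ≤ D := by
    intro i hi
    refine le_trans ?_ (hD (a i))
    rw [← H.card_neighborFinset_eq_degree]
    refine card_le_card_of_injOn a (fun k hk => ?_) (ha.injOn.mono fun k hk => ?_)
    · have := (mem_backNbrs.1 (mem_coe.1 hk)).2
      simpa using this
    · have := (mem_backNbrs.1 (mem_coe.1 hk)).1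
      exact mem_coe.2 (mem_range.2 (this.trans hi))
  obtain ⟨f, hf, -, hfp⟩ := hord.exists_isNondegenerate _ le_rfl (D + 1)
    fun i hi => (hback i hi).trans D.le_succ
  choose r hr hra using fun w => ha.surjOn (Set.mem_univ w)
  have key : ∀ v w, r w < r v → (f (r w) ⬝ᵥ f (r v) ≠ 0 ↔ ¬ H.Adj v w) := by
    intro v w hlt
    have hv := hr v
    rw [mem_coe, mem_range] at hv
    refine ⟨fun h hvw => h (hf.orth _ hv _ (mem_backNbrs.2 ⟨hlt, ?_⟩)), fun h =>
      hfp _ (mem_range.2 hv) _ (mem_range.2 hlt) ?_ (Nat.lt_succ_of_le (hback _ hv))⟩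
    · rwa [hra, hra]
    · rwa [hra, hra]
  refine ⟨fun w => WithLp.toLp 2 (f (r w)), fun v w hvw => ?_⟩
  rw [EuclideanSpace.inner_toLp_toLp, star_trivial, SimpleGraph.compl_adj, and_iff_right hvw]
  have hrne : r v ≠ r w := fun h => hvw (by rw [← hra v, ← hra w, h])
  rcases lt_or_gt_of_ne hrne with h | h
  · rw [dotProduct_comm, key w v h, H.adj_comm]
  · exact key v w h

end MinCardinalityOrder

theorem SimpleGraph.Connected.two_le_maxDegree {V : Type*} [Fintype V] {G : SimpleGraph V}
    [DecidableRel G.Adj] (hconn : G.Connected) (hcard : 3 ≤ Fintype.card V) :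
    2 ≤ G.maxDegree := by
  classical
  by_contra! h
  have h₁ := hconn.card_vert_le_card_edgeSet_add_one
  have h₂ := G.sum_degrees_eq_twice_card_edges
  have h₃ : ∑ v, G.degree v ≤ ∑ _v : V, 1 :=
    Finset.sum_le_sum fun v _ => (G.degree_le_maxDegree v).trans (by omega)
  rw [Finset.sum_const, Finset.card_univ, smul_eq_mul, mul_one] at h₃
  rw [Nat.card_eq_fintype_card, Nat.card_eq_fintype_card, ← edgeFinset_card] at h₁
  omega

theorem SimpleGraph.degree_pathGraph_le (n : ℕ) (u : Fin n) [Fintype ((pathGraph n).neighborSet u)] :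
    (pathGraph n).degree u ≤ 2 := by
  classical
  rw [← card_neighborFinset_eq_degree]
  refine (Finset.card_le_card_of_injOn (t := {u.val - 1, u.val + 1}) Fin.val (fun v hv => ?_)
    Fin.val_injective.injOn).trans Finset.card_le_two
  simp only [Finset.mem_coe, mem_neighborFinset, pathGraph_adj] at hv
  simp only [Finset.coe_insert, Finset.coe_singleton, Set.mem_insert_iff, Set.mem_singleton_iff]
  omega

theorem SimpleGraph.degree_sum_inl {V W : Type*} [Fintype V] [Fintype W] (G : SimpleGraph V)
    (H : SimpleGraph W) [DecidableRel G.Adj] [DecidableRel (G ⊕g H).Adj] (v : V) :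
    (G ⊕g H).degree (Sum.inl v) = G.degree v := by
  rw [← card_neighborFinset_eq_degree, ← card_neighborFinset_eq_degree,
    ← Finset.card_map (s := G.neighborFinset v) (Function.Embedding.inl (β := W))]
  congr 1
  ext (x | x) <;> simp

theorem SimpleGraph.degree_sum_inr {V W : Type*} [Fintype V] [Fintype W] (G : SimpleGraph V)
    (H : SimpleGraph W) [DecidableRel H.Adj] [DecidableRel (G ⊕g H).Adj] (w : W) :
    (G ⊕g H).degree (Sum.inr w) = H.degree w := by
  rw [← card_neighborFinset_eq_degree, ← card_neighborFinset_eq_degree,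
    ← Finset.card_map (s := H.neighborFinset w) (Function.Embedding.inr (α := V))]
  congr 1
  ext (x | x) <;> simp

/-- The complement of an extended C-δ graph `G' = P_{2Δ(G)+2} ⊔ G` has an orthogonal
representation in `ℝ^{Δ(G)+1}`. -/
theorem extended_C_delta_compl_orthoRep {V : Type*} [Fintype V]
    (G : SimpleGraph V) [DecidableRel G.Adj]
    (hconn : G.Connected) (hcard : 4 ≤ Fintype.card V) :
    HasOrthoRep ((pathGraph (2 * G.maxDegree + 2) ⊕g G)ᶜ) (G.maxDegree + 1) := by
  classical
  have h2 : 2 ≤ G.maxDegree := hconn.two_le_maxDegree (by omega)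
  refine hasOrthoRep_compl_of_degree_le _ ?_
  rintro (u | v)
  · rw [degree_sum_inl]
    exact (degree_pathGraph_le _ u).trans h2
  · rw [degree_sum_inr]
    exact G.degree_le_maxDegree v
end

section
/- For every n ≥ 4, the complement of the path graph P_n has an orthogonal representation in ℝ^3; consequently msr(complement of P_n) ≤ 3. -/
open SimpleGraph
open scoped RealInnerProductSpace

/-- The cosine of `2 k` takes the value `cos 2` at an integer `k` only for `k = ±1`,
since `π` is irrational. -/
lemma cos_two_mul_intCast_eq_cos_two_iff (k : ℤ) :
    Real.cos (2 * k) = Real.cos 2 ↔ k = 1 ∨ k = -1 := by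
  have eq_zero_of_eq_mul_pi : ∀ z m : ℤ, (m : ℝ) = z * Real.pi → m = 0 := by
    intro z m h
    by_contra hm
    have hz : z ≠ 0 := by
      rintro rfl
      exact hm (by simpa using h)
    exact (irrational_pi.intCast_mul hz).ne_int m h.symm
  constructor
  · intro h
    obtain ⟨z, hz | hz⟩ := Real.cos_eq_cos_iff.1 h
    · have := eq_zero_of_eq_mul_pi z (1 - k) (by push_cast; linarith)
      omega
    · have := eq_zero_of_eq_mul_pi z (1 + k) (by push_cast; linarith)
      omega
  · rintro (rfl | rfl) <;> simp

/-- Points on a circular cone, each rotated by an angle of `2` from its predecessor, such that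
consecutive points are orthogonal. -/
noncomputable def conePoint (k : ℕ) : EuclideanSpace ℝ (Fin 3) :=
  !₂[Real.cos (2 * k), Real.sin (2 * k), √(-Real.cos 2)]

lemma inner_conePoint (i j : ℕ) :
    ⟪conePoint i, conePoint j⟫ = Real.cos (2 * ((i - j : ℤ) : ℝ)) - Real.cos 2 := by
  have h : √(-Real.cos 2) * √(-Real.cos 2) = -Real.cos 2 :=
    Real.mul_self_sqrt (by linarith [Real.cos_two_neg])
  simp only [conePoint, PiLp.inner_apply, Fin.sum_univ_three, RCLike.inner_apply, conj_trivial]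
  simp [mul_sub, Real.cos_sub, h]
  ring

lemma inner_conePoint_eq_zero_iff (i j : ℕ) :
    ⟪conePoint i, conePoint j⟫ = 0 ↔ i + 1 = j ∨ j + 1 = i := by
  rw [inner_conePoint, sub_eq_zero, cos_two_mul_intCast_eq_cos_two_iff]
  omega

lemma hasOrthoRep_compl_pathGraph (n : ℕ) : HasOrthoRep ((pathGraph n)ᶜ) 3 := by
  refine ⟨fun i => conePoint i, fun i j hij => ?_⟩
  rw [Ne, inner_conePoint_eq_zero_iff, compl_adj, pathGraph_adj]
  simp [hij]

/-- For every `n ≥ 4`, the complement of the path graph `P_n` has an orthogonal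
representation in `ℝ^3`; consequently `msr((P_n)ᶜ) ≤ 3`. -/
theorem compl_pathGraph_orthoRep (n : ℕ) (hn : 4 ≤ n) :
    HasOrthoRep ((pathGraph n)ᶜ) 3 ∧ msr ((pathGraph n)ᶜ) ≤ 3 := by
  exact ⟨hasOrthoRep_compl_pathGraph n, Nat.sInf_le (hasOrthoRep_compl_pathGraph n)⟩
end

section
/- Every simple connected graph G satisfies the Delta Conjecture: msr(G) ≤ |G| − δ(G). Equivalently, every simple connected graph G has an orthogonal representation in ℝ^{|G|−δ(G)}. -/
open SimpleGraph
open scoped RealInnerProductSpace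

/-- The determinant of the matrix of pairwise dot products of two families of vectors. -/
def crossGram {R ι : Type*} [CommRing R] [Fintype ι] [DecidableEq ι] {D : ℕ}
    (a b : ι → Fin D → R) : R :=
  (Matrix.of fun i j => a i ⬝ᵥ b j).det

/-- The cross Gram determinant of the family `u` extended by `w` on the left and by `r` on the
right. -/
def borderedGram {R ι : Type*} [CommRing R] [Fintype ι] [DecidableEq ι] {D : ℕ}
    (u : ι → Fin D → R) (r w : Fin D → R) : R :=
  crossGram (Sum.elim u fun _ : Unit => w) (Sum.elim u fun _ : Unit => r)

/-- A vector orthogonal to the family `u`: a multiple of the projection of `r` to the orthogonal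
complement of `u`. -/
def kernelVec {R ι : Type*} [CommRing R] [Fintype ι] [DecidableEq ι] {D : ℕ}
    (u : ι → Fin D → R) (r : Fin D → R) : Fin D → R :=
  fun c => borderedGram u r (Pi.single c 1)

section Gram

variable {R ι κ : Type*} [CommRing R] [Fintype ι] [DecidableEq ι] [Fintype κ] [DecidableEq κ]
  {D : ℕ}

lemma crossGram_comp_equiv (e : κ ≃ ι) (a b : ι → Fin D → R) :
    crossGram (a ∘ e) (b ∘ e) = crossGram a b :=
  Matrix.det_submatrix_equiv_self e (Matrix.of fun i j => a i ⬝ᵥ b j)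

lemma crossGram_map {S : Type*} [CommRing S] (φ : R →+* S) (a b : ι → Fin D → R) :
    φ (crossGram a b) = crossGram (fun i => φ ∘ a i) (fun i => φ ∘ b i) := by
  unfold crossGram
  rw [RingHom.map_det]
  congr 1
  ext i j
  simp [dotProduct]

lemma crossGram_smul (c : ι → R) (a : ι → Fin D → R) :
    crossGram (fun i => c i • a i) (fun i => c i • a i) =
      (∏ i, c i) * ((∏ i, c i) * crossGram a a) := by
  unfold crossGram
  rw [← Matrix.det_mul_column, ← Matrix.det_mul_row]
  congr 1
  ext i j
  simp [smul_dotProduct, dotProduct_smul]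

lemma kernelVec_dotProduct (u : ι → Fin D → R) (r w : Fin D → R) :
    kernelVec u r ⬝ᵥ w = borderedGram u r w := by
  let b : ι ⊕ Unit → Fin D → R := Sum.elim u fun _ => r
  let m : Matrix (ι ⊕ Unit) (ι ⊕ Unit) R := Matrix.of fun i j => (Sum.elim u fun _ => 0) i ⬝ᵥ b j
  let f : (Fin D → R) →ₗ[R] R :=
    (Matrix.detRowAlternating.toMultilinearMap.toLinearMap m (Sum.inr ())).comp
      (Matrix.of b).mulVecLin
  have hf : ∀ w, borderedGram u r w = f w := by
    intro w
    change Matrix.det _ = Matrix.det (Function.update m (Sum.inr ()) _)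
    congr 1
    ext i j
    rcases i with i | i
    · simp [m, b, Function.update]
    · simp [b, Function.update, Matrix.mulVec, dotProduct_comm]
  rw [hf, LinearMap.pi_apply_eq_sum_univ f w, dotProduct]
  refine Finset.sum_congr rfl fun c _ => ?_
  rw [kernelVec, hf, smul_eq_mul, mul_comm]
  congr 2
  ext j
  simp [Pi.single_apply, eq_comm]

lemma borderedGram_self (u : ι → Fin D → R) (r : Fin D → R) (s : ι) :
    borderedGram u r (u s) = 0 :=
  Matrix.det_zero_of_row_eq (i := Sum.inl s) (j := Sum.inr ()) (by simp) (by ext j; simp)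

lemma borderedGram_of_orthogonal (u : ι → Fin D → R) (r w : Fin D → R)
    (h : ∀ s, u s ⬝ᵥ r = 0) : borderedGram u r w = crossGram u u * (w ⬝ᵥ r) := by
  have : (Matrix.of fun i j => (Sum.elim u fun _ : Unit => w) i ⬝ᵥ
      (Sum.elim u fun _ : Unit => r) j) =
      Matrix.fromBlocks (Matrix.of fun i j => u i ⬝ᵥ u j) 0
        (Matrix.of fun _ j => w ⬝ᵥ u j) (Matrix.of fun _ _ => w ⬝ᵥ r) := by
    ext (i | i) (j | j) <;> simp [h]
  rw [borderedGram, crossGram, this, Matrix.det_fromBlocks_zero₁₂,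
    Matrix.det_unique (n := Unit)]
  rfl

lemma kernelVec_of_orthogonal (u : ι → Fin D → R) (r : Fin D → R)
    (h : ∀ s, u s ⬝ᵥ r = 0) : kernelVec u r = crossGram u u • r := by
  ext c
  simp [kernelVec, borderedGram_of_orthogonal u r _ h]

lemma kernelVec_map {S : Type*} [CommRing S] (φ : R →+* S) (u : ι → Fin D → R)
    (r : Fin D → R) : φ ∘ kernelVec u r = kernelVec (fun i => φ ∘ u i) (φ ∘ r) := by
  ext c
  simp only [Function.comp_apply, kernelVec, borderedGram, crossGram_map]
  congr 1
  · ext (i | i) d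
    · rfl
    · by_cases hd : d = c <;> simp [hd]
  · ext (i | i) d <;> rfl

lemma crossGram_insert (v : ℕ → Fin D → R) {x : ℕ} {I : Finset ℕ} (hx : x ∉ I) :
    crossGram (fun s : ↥(insert x I) => v s) (fun s => v s) =
      borderedGram (fun s : I => v s) (v x) (v x) := by
  let e : ↥(insert x I) ≃ I ⊕ Unit :=
    (Finset.subtypeInsertEquivOption hx).trans (Equiv.optionEquivSumPUnit _)
  have h : (fun s : ↥(insert x I) => v s) ∘ e.symm =
      Sum.elim (fun s : I => v s) fun _ => v x := by
    ext (i | i) c <;> simp [e, Finset.subtypeInsertEquivOption]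
  rw [← crossGram_comp_equiv e.symm, h, borderedGram]

end Gram

/-- The vectors obtained from the parameters `r` by making, one after the other, the `j`-th vector
orthogonal to the earlier vectors whose index is not in `N j`. -/
def genVec {R : Type*} [CommRing R] {D : ℕ} (N : ℕ → Finset ℕ) (r : ℕ → Fin D → R) (j : ℕ) :
    Fin D → R :=
  kernelVec (fun s : ↥(Finset.range j \ N j) => genVec N r s) (r j)
termination_by j
decreasing_by
  exact Finset.mem_range.1 (Finset.mem_sdiff.1 s.2).1

section Generic

variable {D : ℕ} (N : ℕ → Finset ℕ)

lemma genVec_map {R S : Type*} [CommRing R] [CommRing S] (φ : R →+* S) (r : ℕ → Fin D → R)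
    (j : ℕ) : φ ∘ genVec N r j = genVec N (fun i => φ ∘ r i) j := by
  induction j using Nat.strong_induction_on with
  | _ j ih =>
    rw [genVec, genVec, kernelVec_map]
    congr 1
    ext s : 1
    exact ih s (Finset.mem_range.1 (Finset.mem_sdiff.1 s.2).1)

lemma genVec_congr {R : Type*} [CommRing R] {r r' : ℕ → Fin D → R} (j : ℕ)
    (h : ∀ i ≤ j, r i = r' i) : genVec N r j = genVec N r' j := by
  induction j using Nat.strong_induction_on with
  | _ j ih =>
    rw [genVec, genVec, h j le_rfl]
    congr 1
    ext s : 1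
    have hs := Finset.mem_range.1 (Finset.mem_sdiff.1 s.2).1
    exact ih s hs fun i hi => h i (hi.trans hs.le)

lemma genVec_dotProduct_eq_zero {R : Type*} [CommRing R] (r : ℕ → Fin D → R) {s j : ℕ}
    (hs : s ∈ Finset.range j \ N j) : genVec N r j ⬝ᵥ genVec N r s = 0 := by
  rw [genVec, kernelVec_dotProduct]
  exact borderedGram_self (fun s : ↥(Finset.range j \ N j) => genVec N r s) _ ⟨s, hs⟩

/-- The Gram determinant of the vectors `genVec N r s` with `s ∈ I`. -/
def genGram {R : Type*} [CommRing R] (r : ℕ → Fin D → R) (I : Finset ℕ) : R :=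
  crossGram (fun s : I => genVec N r s) (fun s : I => genVec N r s)

lemma genVec_eq_smul {p : ℕ} (v : ℕ → Fin D → ℝ)
    (horth : ∀ j < p, ∀ s ∈ Finset.range j \ N j, v s ⬝ᵥ v j = 0)
    (hgram : ∀ j < p, crossGram (fun s : ↥(Finset.range j \ N j) => v s) (fun s => v s) ≠ 0) :
    ∀ j < p, ∃ c : ℝ, c ≠ 0 ∧ genVec N v j = c • v j := by
  intro j
  induction j using Nat.strong_induction_on with
  | _ j ih =>
    intro hj
    have hlt (s : ↥(Finset.range j \ N j)) : (s : ℕ) < j :=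
      Finset.mem_range.1 (Finset.mem_sdiff.1 s.2).1
    choose c hc0 hc using fun s : ↥(Finset.range j \ N j) => ih s (hlt s) ((hlt s).trans hj)
    have hprod : ∏ s, c s ≠ 0 := Finset.prod_ne_zero_iff.2 fun s _ => hc0 s
    refine ⟨crossGram (fun s : ↥(Finset.range j \ N j) => c s • v s) (fun s => c s • v s), ?_, ?_⟩
    · rw [crossGram_smul]
      exact mul_ne_zero hprod (mul_ne_zero hprod (hgram j hj))
    · rw [genVec, funext hc, kernelVec_of_orthogonal]
      intro s
      rw [smul_dotProduct, horth j hj s s.2, smul_zero]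

/-- Finitely many polynomials over `ℝ`, none of which vanishes everywhere, have a common point
where none of them vanishes. -/
lemma exists_eval_ne_zero {σ α : Type*} (A : Finset α) (P : α → MvPolynomial σ ℝ)
    (h : ∀ a ∈ A, ∃ r, MvPolynomial.eval r (P a) ≠ 0) :
    ∃ r, ∀ a ∈ A, MvPolynomial.eval r (P a) ≠ 0 := by
  have hP : ∏ a ∈ A, P a ≠ 0 := Finset.prod_ne_zero_iff.2 fun a ha h0 => by
    obtain ⟨r, hr⟩ := h a ha
    simp [h0] at hr
  obtain ⟨r, hr⟩ : ∃ r, MvPolynomial.eval r (∏ a ∈ A, P a) ≠ 0 := by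
    by_contra! h0
    exact hP (MvPolynomial.funext fun r => by simpa using h0 r)
  rw [map_prod] at hr
  exact ⟨r, fun a ha => Finset.prod_ne_zero_iff.1 hr a ha⟩

/-- The vectors `genVec` at the generic parameters. -/
noncomputable def polyVec (D : ℕ) (j : ℕ) : Fin D → MvPolynomial (ℕ × Fin D) ℝ :=
  genVec N (fun i c => MvPolynomial.X (i, c)) j

lemma eval_polyVec (r : ℕ × Fin D → ℝ) (j : ℕ) :
    MvPolynomial.eval r ∘ polyVec N D j = genVec N (fun i c => r (i, c)) j := by
  rw [polyVec, genVec_map]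
  congr 1
  ext i c
  simp

lemma exists_genGram_ne_zero_of_forall (A : Finset (Finset ℕ))
    (h : ∀ I ∈ A, ∃ r : ℕ → Fin D → ℝ, genGram N r I ≠ 0) :
    ∃ r : ℕ → Fin D → ℝ, ∀ I ∈ A, genGram N r I ≠ 0 := by
  have key (r : ℕ × Fin D → ℝ) (I : Finset ℕ) :
      MvPolynomial.eval r
        (crossGram (fun s : I => polyVec N D s) (fun s : I => polyVec N D s)) =
        genGram N (fun i c => r (i, c)) I := by
    rw [crossGram_map]
    simp only [eval_polyVec, genGram]
  obtain ⟨r, hr⟩ := exists_eval_ne_zero A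
    (fun I => crossGram (fun s : I => polyVec N D s) (fun s : I => polyVec N D s))
    fun I hI => by
      obtain ⟨r, hr⟩ := h I hI
      exact ⟨fun x => r x.1 x.2, by rw [key]; exact hr⟩
  exact ⟨fun i c => r (i, c), fun I hI => by rw [← key]; exact hr I hI⟩

lemma exists_genVec_dotProduct_ne_zero_of_forall (A : Finset (ℕ × ℕ))
    (h : ∀ x ∈ A, ∃ r : ℕ → Fin D → ℝ, genVec N r x.1 ⬝ᵥ genVec N r x.2 ≠ 0) :
    ∃ r : ℕ → Fin D → ℝ, ∀ x ∈ A, genVec N r x.1 ⬝ᵥ genVec N r x.2 ≠ 0 := by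
  have key (r : ℕ × Fin D → ℝ) (i k : ℕ) :
      MvPolynomial.eval r (polyVec N D i ⬝ᵥ polyVec N D k) =
        genVec N (fun i c => r (i, c)) i ⬝ᵥ genVec N (fun i c => r (i, c)) k := by
    rw [← eval_polyVec, ← eval_polyVec, RingHom.map_dotProduct]
  obtain ⟨r, hr⟩ := exists_eval_ne_zero A (fun x => polyVec N D x.1 ⬝ᵥ polyVec N D x.2)
    fun x hx => by
      obtain ⟨r, hr⟩ := h x hx
      exact ⟨fun x => r x.1 x.2, by rw [key]; exact hr⟩
  exact ⟨fun i c => r (i, c), fun x hx => by rw [← key]; exact hr x hx⟩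

/-- For a maximum adjacency ordering with sets of earlier neighbours `N j`, the vectors outside a
set `Y` that never has more elements among the first `j` indices than `N j` are generically
independent, as soon as there are at most `D` of them. -/
theorem exists_genGram_ne_zero (hN : ∀ i j, i < j → (N j ∩ Finset.range i).card ≤ (N i).card)
    (hsub : ∀ j, N j ⊆ Finset.range j) (p : ℕ) :
    ∀ (D : ℕ) (Y : Finset ℕ), (∀ j < p, (Y ∩ Finset.range j).card ≤ (N j).card) →
      (Finset.range p \ Y).card ≤ D →
      ∃ r : ℕ → Fin D → ℝ, genGram N r (Finset.range p \ Y) ≠ 0 := by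
  induction p using Nat.strong_induction_on with
  | _ p ih =>
  intro D Y hY hD
  rcases p with _ | p
  · have : IsEmpty ↥(Finset.range 0 \ Y) := ⟨fun s => by simpa using s.2⟩
    refine ⟨0, ?_⟩
    rw [genGram, crossGram, Matrix.det_isEmpty]
    exact one_ne_zero
  by_cases hp : p ∈ Y
  · have hset : Finset.range (p + 1) \ Y = Finset.range p \ Y := by
      rw [Finset.range_add_one, Finset.insert_sdiff_of_mem _ hp]
    rw [hset] at hD ⊢
    exact ih p p.lt_succ_self D Y (fun j hj => hY j (hj.trans p.lt_succ_self)) hD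
  have hset : Finset.range (p + 1) \ Y = insert p (Finset.range p \ Y) := by
    rw [Finset.range_add_one, Finset.insert_sdiff_of_notMem _ hp]
  have hpI : p ∉ Finset.range p \ Y := by simp
  rw [hset, Finset.card_insert_of_notMem hpI] at hD
  obtain ⟨E, rfl⟩ : ∃ E, D = E + 1 := ⟨D - 1, by omega⟩
  have hcard : ∀ j < p + 1, (Finset.range j \ N j).card ≤ E := by
    intro j hj
    have h1 := Finset.card_sdiff_add_card_inter (Finset.range j) (N j)
    have h2 := Finset.card_sdiff_add_card_inter (Finset.range j) Y
    rw [Finset.inter_eq_right.2 (hsub j)] at h1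
    rw [Finset.inter_comm] at h2
    have h3 := hY j hj
    have h4 : (Finset.range j \ Y).card ≤ (Finset.range p \ Y).card :=
      Finset.card_le_card (Finset.sdiff_subset_sdiff
        (Finset.range_subset_range.2 (Nat.lt_succ_iff.1 hj)) subset_rfl)
    omega
  obtain ⟨r, hr⟩ := exists_genGram_ne_zero_of_forall (D := E) N
    (insert (Finset.range p \ Y) ((Finset.range (p + 1)).image fun j => Finset.range j \ N j))
    (by
      intro I hI
      rcases Finset.mem_insert.1 hI with rfl | hI
      · exact ih p p.lt_succ_self E Y (fun j hj => hY j (hj.trans p.lt_succ_self)) (by omega)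
      · obtain ⟨j, hj, rfl⟩ := Finset.mem_image.1 hI
        rw [Finset.mem_range] at hj
        exact ih j hj E (N j) (fun i hi => hN i j hi) (hcard j hj))
  let u : ℕ → Fin E → ℝ := genVec N r
  let v : ℕ → Fin (E + 1) → ℝ := fun j =>
    if j < p then Fin.snoc (u j) 0 else Pi.single (Fin.last E) 1
  have hvv : ∀ i < p, ∀ j < p, v i ⬝ᵥ v j = u i ⬝ᵥ u j := by
    intro i hi j hj
    simp [v, hi, hj, dotProduct, Fin.sum_univ_castSucc]
  have hvp : ∀ i < p, v i ⬝ᵥ v p = 0 := by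
    intro i hi
    simp [v, hi]
  have hgram : ∀ I : Finset ℕ, I ⊆ Finset.range p →
      crossGram (fun s : I => v s) (fun s => v s) = genGram N r I := by
    intro I hI
    unfold genGram crossGram
    congr 1
    ext s t
    exact hvv s (Finset.mem_range.1 (hI s.2)) t (Finset.mem_range.1 (hI t.2))
  have hsmul := genVec_eq_smul N (p := p + 1) v
    (by
      intro j hj s hs
      have hsj := Finset.mem_range.1 (Finset.mem_sdiff.1 hs).1
      rcases Nat.lt_succ_iff_lt_or_eq.1 hj with hj' | rfl
      · rw [hvv s (hsj.trans hj') j hj', dotProduct_comm]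
        exact genVec_dotProduct_eq_zero N r hs
      · exact hvp s hsj)
    (by
      intro j hj
      rw [hgram _ (Finset.sdiff_subset.trans
        (Finset.range_subset_range.2 (Nat.lt_succ_iff.1 hj)))]
      exact hr _ (Finset.mem_insert_of_mem
        (Finset.mem_image_of_mem _ (Finset.mem_range.2 hj))))
  have hlt (s : ↥(insert p (Finset.range p \ Y))) : (s : ℕ) < p + 1 := by
    have := s.2
    simp only [Finset.mem_insert, Finset.mem_sdiff, Finset.mem_range] at this
    omega
  choose c hc0 hc using fun s : ↥(insert p (Finset.range p \ Y)) => hsmul s (hlt s)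
  have hprod : ∏ s, c s ≠ 0 := Finset.prod_ne_zero_iff.2 fun s _ => hc0 s
  refine ⟨v, ?_⟩
  rw [hset, genGram, funext hc, crossGram_smul]
  refine mul_ne_zero hprod (mul_ne_zero hprod ?_)
  rw [crossGram_insert v hpI, borderedGram_of_orthogonal, hgram _ Finset.sdiff_subset]
  · refine mul_ne_zero (hr _ (Finset.mem_insert_self _ _)) ?_
    simp [v]
  · intro s
    exact hvp s (Finset.mem_range.1 (Finset.mem_sdiff.1 s.2).1)

/-- For a maximum adjacency ordering, the generic vectors of two adjacent vertices are not
orthogonal. -/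
lemma exists_genVec_dotProduct_ne_zero
    (hN : ∀ i j, i < j → (N j ∩ Finset.range i).card ≤ (N i).card)
    (hsub : ∀ j, N j ⊆ Finset.range j) {i k : ℕ} (hk : k ∈ N i) (hi : i + 1 ≤ D + (N i).card) :
    ∃ r : ℕ → Fin D → ℝ, genVec N r i ⬝ᵥ genVec N r k ≠ 0 := by
  have hki : k < i := Finset.mem_range.1 (hsub i hk)
  have hkS : k ∉ Finset.range i \ N i := by simp [hk]
  have hset : Finset.range i \ (N i).erase k = insert k (Finset.range i \ N i) :=
    Finset.sdiff_erase (Finset.mem_range.2 hki)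
  obtain ⟨r, hr⟩ := exists_genGram_ne_zero N hN hsub i D ((N i).erase k)
    (fun j hj => (Finset.card_le_card
      (Finset.inter_subset_inter_right (Finset.erase_subset _ _))).trans (hN j i hj))
    (by
      have := Finset.card_sdiff_add_card_eq_card (hsub i)
      rw [Finset.card_range] at this
      rw [hset, Finset.card_insert_of_notMem hkS]
      omega)
  have hlt : ∀ j < i, genVec N (Function.update r i (genVec N r k)) j = genVec N r j :=
    fun j hj => genVec_congr N j fun l hl => Function.update_of_ne (by omega) _ _
  refine ⟨Function.update r i (genVec N r k), ?_⟩
  have hfam : (fun s : ↥(Finset.range i \ N i) =>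
      genVec N (Function.update r i (genVec N r k)) s) =
      fun s : ↥(Finset.range i \ N i) => genVec N r s :=
    funext fun s => hlt s (Finset.mem_range.1 (Finset.mem_sdiff.1 s.2).1)
  rw [hlt k hki, genVec, hfam, Function.update_self, kernelVec_dotProduct,
    ← crossGram_insert (genVec N r) hkS, ← hset]
  exact hr

end Generic

/-- Every finite graph has a maximum adjacency ordering. -/
lemma exists_maxAdjacency_ordering {V : Type*} [Fintype V] [Nonempty V] (G : SimpleGraph V)
    [DecidableRel G.Adj] (k : ℕ) (hk : k ≤ Fintype.card V) :
    ∃ g : ℕ → V, Set.InjOn g (Set.Iio k) ∧ ∀ i < k, ∀ w, (∀ l < i, g l ≠ w) →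
      ((Finset.range i).filter fun l => G.Adj w (g l)).card ≤
        ((Finset.range i).filter fun l => G.Adj (g i) (g l)).card := by
  classical
  induction k with
  | zero => exact ⟨fun _ => Classical.arbitrary V, by simp [Set.InjOn], by simp⟩
  | succ k ih =>
    obtain ⟨g, hinj, hg⟩ := ih (by omega)
    let B : Finset V := Finset.univ \ (Finset.range k).image g
    have hB : B.Nonempty := by
      rw [← Finset.card_pos]
      have h1 := Finset.card_sdiff_add_card_eq_card (Finset.subset_univ ((Finset.range k).image g))
      have h2 : ((Finset.range k).image g).card ≤ k := by
        simpa using Finset.card_image_le (s := Finset.range k) (f := g)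
      rw [Finset.card_univ] at h1
      change 0 < (Finset.univ \ (Finset.range k).image g).card
      omega
    have hmemB (w : V) : w ∈ B ↔ ∀ l < k, g l ≠ w := by simp [B]
    obtain ⟨b, hb, hmax⟩ := B.exists_max_image
      (fun w => ((Finset.range k).filter fun l => G.Adj w (g l)).card) hB
    rw [hmemB] at hb
    have hlt : ∀ l < k, Function.update g k b l = g l := fun l hl =>
      Function.update_of_ne hl.ne _ _
    refine ⟨Function.update g k b, ?_, ?_⟩
    · intro x hx y hy hxy
      simp only [Set.mem_Iio] at hx hy
      rcases Nat.lt_succ_iff_lt_or_eq.1 hx with hx | rfl <;>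
        rcases Nat.lt_succ_iff_lt_or_eq.1 hy with hy | rfl
      · rw [hlt x hx, hlt y hy] at hxy
        exact hinj hx hy hxy
      · rw [hlt x hx, Function.update_self] at hxy
        exact absurd hxy (hb x hx)
      · rw [hlt y hy, Function.update_self] at hxy
        exact absurd hxy.symm (hb y hy)
      · rfl
    · intro i hi w hw
      have hfil (z : V) : ((Finset.range i).filter fun l => G.Adj z (Function.update g k b l)) =
          (Finset.range i).filter fun l => G.Adj z (g l) :=
        Finset.filter_congr fun l hl => by
          rw [hlt l (by rw [Finset.mem_range] at hl; omega)]
      have hw' : ∀ l < i, g l ≠ w := fun l hl => by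
        rw [← hlt l (by omega)]
        exact hw l hl
      rw [hfil, hfil]
      rcases Nat.lt_succ_iff_lt_or_eq.1 hi with hi | rfl
      · rw [hlt i hi]
        exact hg i hi w hw'
      · rw [Function.update_self]
        exact hmax w ((hmemB w).2 hw')

/-- Every finite nonempty graph `G` has an orthogonal representation in `ℝ^(|G| - δ(G))`. -/
theorem hasOrthoRep_card_sub_minDegree {V : Type*} [Fintype V] [Nonempty V] (G : SimpleGraph V)
    [DecidableRel G.Adj] : HasOrthoRep G (Fintype.card V - G.minDegree) := by
  classical
  obtain ⟨g, hinj, hg⟩ := exists_maxAdjacency_ordering G (Fintype.card V) le_rfl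
  set n := Fintype.card V with hn
  have hn0 : 0 < n := Fintype.card_pos
  have himg : (Finset.range n).image g = Finset.univ := by
    rw [← Finset.card_eq_iff_eq_univ, Finset.card_image_of_injOn, Finset.card_range]
    intro x hx y hy
    exact hinj (by simpa using hx) (by simpa using hy)
  have hsurj (w : V) : ∃ l < n, g l = w := by
    have : w ∈ (Finset.range n).image g := himg ▸ Finset.mem_univ w
    simpa using this
  let N : ℕ → Finset ℕ := fun j =>
    if j < n then (Finset.range j).filter fun l => G.Adj (g j) (g l) else ∅
  have hNj : ∀ j < n, N j = (Finset.range j).filter fun l => G.Adj (g j) (g l) :=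
    fun j hj => if_pos hj
  have hsub : ∀ j, N j ⊆ Finset.range j := by
    intro j
    by_cases hj : j < n
    · rw [hNj j hj]
      exact Finset.filter_subset _ _
    · simp [N, hj]
  have hne : ∀ i < n, ∀ l < i, g l ≠ g i := fun i hi l hl h =>
    hl.ne (hinj (hl.trans hi) hi h)
  have hN : ∀ i j, i < j → (N j ∩ Finset.range i).card ≤ (N i).card := by
    intro i j hij
    by_cases hj : j < n
    · rw [hNj i (hij.trans hj)]
      refine le_trans (Finset.card_le_card ?_)
        (hg i (hij.trans hj) (g j) fun l hl => hne j hj l (hl.trans hij))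
      intro l hl
      rw [hNj j hj] at hl
      simp only [Finset.mem_inter, Finset.mem_filter, Finset.mem_range] at hl ⊢
      exact ⟨hl.2, hl.1.2⟩
    · simp [N, hj]
  have hdeg : ∀ i < n, i + 1 ≤ n - G.minDegree + (N i).card := by
    intro i hi
    let z := g (n - 1)
    have h1 : G.minDegree ≤ G.degree z := G.minDegree_le_degree z
    have h2 : ((Finset.range i).filter fun l => G.Adj z (g l)).card ≤ (N i).card := by
      rw [hNj i hi]
      exact hg i hi z fun l hl => hne (n - 1) (by omega) l (by omega)
    have h3 : G.neighborFinset z ⊆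
        ((Finset.range i).filter fun l => G.Adj z (g l)).image g ∪
          (Finset.Ico i (n - 1)).image g := by
      intro w hw
      rw [SimpleGraph.mem_neighborFinset] at hw
      obtain ⟨l, hl, rfl⟩ := hsurj w
      have hl' : l ≠ n - 1 := by
        rintro rfl
        exact G.irrefl hw
      simp only [Finset.mem_union, Finset.mem_image, Finset.mem_filter, Finset.mem_range,
        Finset.mem_Ico]
      by_cases hli : l < i
      · exact Or.inl ⟨l, ⟨hli, hw⟩, rfl⟩
      · exact Or.inr ⟨l, by omega, rfl⟩
    have h4 := (Finset.card_le_card h3).trans (Finset.card_union_le _ _)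
    have h5 : (((Finset.range i).filter fun l => G.Adj z (g l)).image g).card ≤ _ :=
      Finset.card_image_le
    have h6 : ((Finset.Ico i (n - 1)).image g).card ≤ _ := Finset.card_image_le
    rw [Nat.card_Ico] at h6
    rw [SimpleGraph.card_neighborFinset_eq_degree] at h4
    omega
  obtain ⟨r, hr⟩ := exists_genVec_dotProduct_ne_zero_of_forall (D := n - G.minDegree) N
    ((Finset.range n ×ˢ Finset.range n).filter fun x => x.2 ∈ N x.1)
    (by
      rintro ⟨i, k⟩ hx
      simp only [Finset.mem_filter, Finset.mem_product, Finset.mem_range] at hx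
      exact exists_genVec_dotProduct_ne_zero N hN hsub hx.2 (hdeg i hx.1.1))
  have hlt : ∀ i < n, ∀ k < i, genVec N r i ⬝ᵥ genVec N r k ≠ 0 ↔ G.Adj (g i) (g k) := by
    intro i hi k hk
    by_cases hadj : G.Adj (g i) (g k)
    · have hkN : k ∈ N i := by simp [hNj i hi, hk, hadj]
      refine iff_of_true (hr (i, k) ?_) hadj
      simp [hi, hk.trans hi, hkN]
    · have hkN : k ∈ Finset.range i \ N i := by simp [hNj i hi, hk, hadj]
      simp [genVec_dotProduct_eq_zero N r hkN, hadj]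
  choose idx hidx hgidx using hsurj
  refine ⟨fun w => WithLp.toLp 2 (genVec N r (idx w)), fun a b hab => ?_⟩
  rw [EuclideanSpace.inner_toLp_toLp]
  simp only [star_trivial]
  have hab' : idx a ≠ idx b := fun h => hab (by rw [← hgidx a, ← hgidx b, h])
  rcases lt_or_gt_of_ne hab' with h | h
  · rw [hlt _ (hidx b) _ h, hgidx, hgidx, G.adj_comm]
  · rw [dotProduct_comm, hlt _ (hidx a) _ h, hgidx, hgidx]

/-- Delta Conjecture: every simple connected graph `G` satisfies
`msr(G) ≤ |G| - δ(G)`; equivalently, `G` has an orthogonal representation in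
`ℝ^{|G| - δ(G)}`. -/
theorem delta_conjecture {V : Type*} [Fintype V]
    (G : SimpleGraph V) [DecidableRel G.Adj] (hconn : G.Connected) :
    msr G ≤ Fintype.card V - G.minDegree ∧
    HasOrthoRep G (Fintype.card V - G.minDegree) := by
  have := hconn.nonempty
  have h := hasOrthoRep_card_sub_minDegree G
  exact ⟨Nat.sInf_le h, h⟩
end

section
/- The complement of the Cartesian (box) product K_3 □ P_4 is a δ-graph; in particular, the complement of K_3 □ P_4 has an orthogonal representation in ℝ^5, so msr(complement of K_3 □ P_4) ≤ Δ(K_3 □ P_4) + 1 = 5. -/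
open SimpleGraph
open scoped RealInnerProductSpace

noncomputable instance : DecidableRel (((⊤ : SimpleGraph (Fin 3)) □ pathGraph 4).Adj) :=
  Classical.decRel _

/-- Adjacency in `Kₘ □ Pₙ`, in decidable form. -/
theorem top_boxProd_pathGraph_adj_iff {m n : ℕ} (x y : Fin m × Fin n) :
    ((⊤ : SimpleGraph (Fin m)) □ pathGraph n).Adj x y ↔
      (x.1 ≠ y.1 ∧ x.2 = y.2) ∨
        ((x.2.val + 1 = y.2.val ∨ y.2.val + 1 = x.2.val) ∧ x.1 = y.1) := by
  rw [boxProd_adj, pathGraph_adj, top_adj]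

theorem isDeltaLabeling_compl_top_boxProd_pathGraph :
    IsDeltaLabeling (((⊤ : SimpleGraph (Fin 3)) □ pathGraph 4)ᶜ)
      (finProdFinEquiv (m := 3) (n := 4)).symm := by
  refine ⟨by norm_num, ?_, ?_, ?_, ?_⟩
  · have common_neighbor : ∀ x y : Fin 3 × Fin 4, ∃ z,
        (((⊤ : SimpleGraph (Fin 3)) □ pathGraph 4)ᶜ).Adj x z ∧
        (((⊤ : SimpleGraph (Fin 3)) □ pathGraph 4)ᶜ).Adj z y := by
      simp only [compl_adj, top_boxProd_pathGraph_adj_iff]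
      decide
    refine (connected_iff _).2 ⟨fun x y => ?_, inferInstance⟩
    obtain ⟨z, hxz, hzy⟩ := common_neighbor x y
    exact hxz.reachable.trans hzy.reachable
  · rw [compl_compl]
    exact connected_top.boxProd (pathGraph_connected 3)
  · simp only [compl_adj, top_boxProd_pathGraph_adj_iff]
    rw [Set.ncard_eq_toFinset_card']
    decide
  · simp only [compl_adj, top_boxProd_pathGraph_adj_iff, Set.ncard_eq_toFinset_card']
    decide

/-- An integer orthogonal representation of the complement of `K₃ □ P₄`. -/
def orthoRepVector : Fin 3 → Fin 4 → Fin 5 → ℤ :=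
  ![![![0, -1, -1, 1, -1], ![1, 1, 1, 1, -1], ![-1, 1, 1, -1, 0], ![0, 0, 1, 1, 1]],
    ![![-1, -1, 1, -1, -1], ![-1, 1, -1, 0, -1], ![0, 0, 1, 1, -1], ![0, -1, 1, -1, 0]],
    ![![0, -1, 0, 0, 1], ![-1, 0, 1, 0, 0], ![1, 0, 1, 0, 1], ![0, 1, 1, 0, -1]]]

/-- An integer-valued orthogonal representation gives one over `ℝ`. -/
theorem hasOrthoRep_of_int {V : Type*} {G : SimpleGraph V} {d : ℕ} (f : V → Fin d → ℤ)
    (hf : ∀ i j, i ≠ j → (f i ⬝ᵥ f j ≠ 0 ↔ G.Adj i j)) : HasOrthoRep G d := by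
  refine ⟨fun i => WithLp.toLp 2 fun k => (f i k : ℝ), fun i j hij => ?_⟩
  rw [← hf i j hij, ← Int.cast_ne_zero (α := ℝ)]
  simp [PiLp.inner_apply, dotProduct, mul_comm]

theorem hasOrthoRep_compl_top_boxProd_pathGraph :
    HasOrthoRep (((⊤ : SimpleGraph (Fin 3)) □ pathGraph 4)ᶜ) 5 := by
  refine hasOrthoRep_of_int (fun x => orthoRepVector x.1 x.2) ?_
  simp only [compl_adj, top_boxProd_pathGraph_adj_iff]
  decide

theorem maxDegree_top_boxProd_pathGraph :
    ((⊤ : SimpleGraph (Fin 3)) □ pathGraph 4).maxDegree = 4 := by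
  have degree_eq (x : Fin 3 × Fin 4) :
      ((⊤ : SimpleGraph (Fin 3)) □ pathGraph 4).degree x =
        (Finset.univ.filter fun y : Fin 3 × Fin 4 => (x.1 ≠ y.1 ∧ x.2 = y.2) ∨
          ((x.2.val + 1 = y.2.val ∨ y.2.val + 1 = x.2.val) ∧ x.1 = y.1)).card := by
    rw [← card_neighborFinset_eq_degree]
    congr 1
    ext y
    rw [mem_neighborFinset, top_boxProd_pathGraph_adj_iff, Finset.mem_filter_univ]
  apply le_antisymm
  · refine maxDegree_le_of_forall_degree_le _ 4 fun x => ?_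
    rw [degree_eq]
    revert x
    decide
  · refine le_trans ?_ (degree_le_maxDegree _ ((0, 1) : Fin 3 × Fin 4))
    rw [degree_eq]
    decide

/-- The complement of `K₃ □ P₄` is a δ-graph; in particular it has an orthogonal
representation in `ℝ^5`, so `msr((K₃ □ P₄)ᶜ) ≤ Δ(K₃ □ P₄) + 1 = 5`. -/
theorem compl_K3_boxProd_P4_deltaGraph :
    IsDeltaGraph (((⊤ : SimpleGraph (Fin 3)) □ pathGraph 4)ᶜ) ∧
    HasOrthoRep (((⊤ : SimpleGraph (Fin 3)) □ pathGraph 4)ᶜ) 5 ∧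
    msr (((⊤ : SimpleGraph (Fin 3)) □ pathGraph 4)ᶜ) ≤ 5 ∧
    ((⊤ : SimpleGraph (Fin 3)) □ pathGraph 4).maxDegree + 1 = 5 := by
  exact ⟨⟨_, _, isDeltaLabeling_compl_top_boxProd_pathGraph⟩,
    hasOrthoRep_compl_top_boxProd_pathGraph,
    Nat.sInf_le hasOrthoRep_compl_top_boxProd_pathGraph,
    congrArg (· + 1) maxDegree_top_boxProd_pathGraph⟩
end

section
/- For every n ≥ 4, the complement of the n-prism (the Cartesian product C_n □ K_2, a 3-regular graph on 2n vertices) has an orthogonal representation in ℝ^4; consequently msr(complement of the n-prism) ≤ Δ(n-prism) + 1 = 4. -/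
open SimpleGraph
open scoped RealInnerProductSpace

noncomputable instance (n : ℕ) :
    DecidableRel ((cycleGraph n □ (⊤ : SimpleGraph (Fin 2))).Adj) :=
  Classical.decRel _

/-- A criterion for the complement of the prism: the inner products of distinct vectors must vanish
exactly on the edges of the prism. -/
theorem hasOrthoRep_compl_prism_iff {n d : ℕ} :
    HasOrthoRep ((cycleGraph n □ (⊤ : SimpleGraph (Fin 2)))ᶜ) d ↔
      ∃ f : Fin n × Fin 2 → EuclideanSpace ℝ (Fin d), ∀ p q, p ≠ q →
        (⟪f p, f q⟫ = 0 ↔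
          (cycleGraph n).Adj p.1 q.1 ∧ p.2 = q.2 ∨ p.2 ≠ q.2 ∧ p.1 = q.1) := by
  refine exists_congr fun f => forall_congr' fun p => forall_congr' fun q => forall_congr' fun h => ?_
  rw [compl_adj, boxProd_adj, top_adj]
  tauto

theorem hasOrthoRep_compl_prism_of_int {n d : ℕ} (f : Fin n × Fin 2 → Fin d → ℤ)
    (hf : ∀ p q, p ≠ q → (∑ k, f p k * f q k = 0 ↔
      (cycleGraph n).Adj p.1 q.1 ∧ p.2 = q.2 ∨ p.2 ≠ q.2 ∧ p.1 = q.1)) :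
    HasOrthoRep ((cycleGraph n □ (⊤ : SimpleGraph (Fin 2)))ᶜ) d := by
  refine hasOrthoRep_compl_prism_iff.2 ⟨fun p => WithLp.toLp 2 fun k => (f p k : ℝ), ?_⟩
  intro p q h
  rw [← hf p q h, PiLp.inner_apply, ← Int.cast_eq_zero (α := ℝ)]
  simp [mul_comm]

theorem hasOrthoRep_compl_prism_four :
    HasOrthoRep ((cycleGraph 4 □ (⊤ : SimpleGraph (Fin 2)))ᶜ) 4 := by
  refine hasOrthoRep_compl_prism_of_int (fun p =>
    (![![![0, 0, 1, -1], ![1, -1, -1, -1]], ![![0, 1, 1, 1], ![0, 1, -1, 0]],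
      ![![1, 1, -1, 0], ![0, 1, 1, 0]], ![![1, -1, 0, 0], ![1, 1, -1, 1]]] :
      Fin 4 → Fin 2 → Fin 4 → ℤ) p.1 p.2) ?_
  decide

theorem hasOrthoRep_compl_prism_six :
    HasOrthoRep ((cycleGraph 6 □ (⊤ : SimpleGraph (Fin 2)))ᶜ) 4 := by
  refine hasOrthoRep_compl_prism_of_int (fun p =>
    (![![![1, 1, 0, -1], ![0, 1, 1, 1]], ![![1, 0, 1, 1], ![1, 1, -1, 0]],
      ![![0, 1, 0, 0], ![0, 0, 0, 1]], ![![0, 0, 1, 1], ![1, 1, 0, 0]],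
      ![![1, 1, 1, -1], ![1, -1, -1, -1]], ![![0, 1, 0, 1], ![0, 1, 0, -1]]] :
      Fin 6 → Fin 2 → Fin 4 → ℤ) p.1 p.2) ?_
  decide

theorem cycleGraph_adj_iff_dvd {n : ℕ} (hn : 2 ≤ n) {u v : Fin n} :
    (cycleGraph n).Adj u v ↔
      (n : ℤ) ∣ (u : ℤ) - (v : ℤ) - 1 ∨ (n : ℤ) ∣ (u : ℤ) - (v : ℤ) + 1 := by
  have sub_val_eq_one : ∀ a b : Fin n, (a - b).val = 1 ↔ (n : ℤ) ∣ (a : ℤ) - (b : ℤ) - 1 := by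
    intro a b
    have hb := b.isLt
    rw [Fin.sub_def, ← Int.natCast_inj]
    push_cast [hb.le]
    rw [show ((n : ℤ) - b + a) = (a - b : ℤ) + n by ring, Int.add_emod_right]
    conv_lhs => rw [← Int.emod_eq_of_lt (a := 1) (b := n) (by norm_num) (by omega)]
    rw [Int.emod_eq_emod_iff_emod_sub_eq_zero, ← Int.dvd_iff_emod_eq_zero]
  rw [cycleGraph_adj', sub_val_eq_one, sub_val_eq_one, ← dvd_neg (b := (v : ℤ) - u - 1)]
  ring_nf

/-- Multiples of a primitive angle `2πl/n` have the same cosine only if they agree up to sign. -/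
theorem cos_mul_eq_cos_mul_iff {n l : ℤ} (hn : n ≠ 0) (hl : IsCoprime n l) (a b : ℤ) :
    Real.cos (a * (2 * Real.pi * l / n)) = Real.cos (b * (2 * Real.pi * l / n)) ↔
      n ∣ a - b ∨ n ∣ a + b := by
  have hn' : (n : ℝ) ≠ 0 := Int.cast_ne_zero.2 hn
  have hpi := Real.pi_ne_zero
  have hdvd (c : ℤ) : n ∣ c ↔ n ∣ l * c := ⟨fun h => h.mul_left l, hl.dvd_of_dvd_mul_left⟩
  rw [hdvd (a - b), hdvd (a + b), Real.cos_eq_cos_iff]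
  constructor
  · rintro ⟨k, h | h⟩
    · refine Or.inl ⟨-k, ?_⟩
      field_simp at h
      have h' : b * l = n * k + l * a := by exact_mod_cast h
      linarith
    · refine Or.inr ⟨k, ?_⟩
      field_simp at h
      have h' : b * l = n * k - l * a := by exact_mod_cast h
      linarith
  · rintro (⟨k, h⟩ | ⟨k, h⟩)
    · refine ⟨-k, Or.inl ?_⟩
      have h' : (l : ℝ) * (a - b) = n * k := by exact_mod_cast h
      push_cast
      field_simp
      linarith
    · refine ⟨k, Or.inr ?_⟩
      have h' : (l : ℝ) * (a + b) = n * k := by exact_mod_cast h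
      field_simp
      linarith

/-- Rotating the phase `π/2 + π/(4n)` by a multiple of a primitive angle `2πl/n` changes its
cosine unless the rotation is trivial. -/
theorem cos_mul_add_eq_cos_iff {n l : ℤ} (hn : n ≠ 0) (hl : IsCoprime n l) (a : ℤ) :
    Real.cos (a * (2 * Real.pi * l / n) + (Real.pi / 2 + Real.pi / (4 * n))) =
      Real.cos (Real.pi / 2 + Real.pi / (4 * n)) ↔ n ∣ a := by
  have hn' : (n : ℝ) ≠ 0 := Int.cast_ne_zero.2 hn
  have hpi := Real.pi_ne_zero
  have hdvd : n ∣ a ↔ n ∣ l * a := ⟨fun h => h.mul_left l, hl.dvd_of_dvd_mul_left⟩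
  rw [hdvd, Real.cos_eq_cos_iff]
  constructor
  · rintro ⟨k, h | h⟩
    · refine ⟨-k, ?_⟩
      field_simp at h
      have h' : (a * l : ℝ) = n * (-k) := by linarith
      rw [mul_comm]
      exact_mod_cast h'
    · exfalso
      field_simp at h
      have h' : (4 * (a * l) + 2 * n + 1 : ℝ) = 4 * (k * n) := by linarith
      have h'' : 4 * (a * l) + 2 * n + 1 = 4 * (k * n) := by exact_mod_cast h'
      omega
  · rintro ⟨k, h⟩
    refine ⟨-k, Or.inl ?_⟩
    have h' : (l * a : ℝ) = n * k := by exact_mod_cast h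
    push_cast
    field_simp
    linarith

/-- Rotating two vectors of the form `(s, t, cos x, sin x)` by multiples of `2πl/n` in the last two
coordinates represents the complement of the prism. -/
theorem hasOrthoRep_compl_prism_of_coprime {n : ℕ} {l : ℤ} (hn : 2 ≤ n) (hl : IsCoprime (n : ℤ) l)
    (hneg : Real.cos (2 * Real.pi * l / n) < 0)
    (hle : |Real.cos (Real.pi / 2 + Real.pi / (4 * n))| ≤ -Real.cos (2 * Real.pi * l / n)) :
    HasOrthoRep ((cycleGraph n □ (⊤ : SimpleGraph (Fin 2)))ᶜ) 4 := by
  have hn0 : (n : ℤ) ≠ 0 := by omega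
  have hone := cos_mul_eq_cos_mul_iff hn0 hl (b := 1)
  have hphase := cos_mul_add_eq_cos_iff hn0 hl
  simp only [Int.cast_natCast, Int.cast_one, one_mul] at hone hphase
  set φ : ℝ := 2 * Real.pi * l / n
  set α : ℝ := Real.pi / 2 + Real.pi / (4 * n)
  obtain ⟨s, hs, hss⟩ : ∃ s : ℝ, s ≠ 0 ∧ s * s = -Real.cos φ :=
    ⟨√(-Real.cos φ), (Real.sqrt_pos.2 (by linarith)).ne', Real.mul_self_sqrt (by linarith)⟩
  have hu : (-Real.cos α / s) * (-Real.cos α / s) ≤ -Real.cos φ := by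
    rw [div_mul_div_comm, hss, div_le_iff₀ (by linarith), neg_mul_neg, ← abs_mul_abs_self]
    exact mul_self_le_mul_self (abs_nonneg _) hle
  obtain ⟨t, ht⟩ : ∃ t : ℝ, (-Real.cos α / s) * (-Real.cos α / s) + t * t = -Real.cos φ :=
    ⟨√(-Real.cos φ - (-Real.cos α / s) * (-Real.cos α / s)), by
      rw [Real.mul_self_sqrt (by linarith)]; ring⟩
  have hsu : s * (-Real.cos α / s) = -Real.cos α := mul_div_cancel₀ _ hs
  set u : ℝ := -Real.cos α / s
  have hadj : ∀ i j : Fin n, Real.cos (((i : ℤ) - (j : ℤ) : ℤ) * φ) = Real.cos φ ↔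
      (cycleGraph n).Adj i j := fun i j => (hone _).trans (cycleGraph_adj_iff_dvd hn).symm
  have heq : ∀ i j : Fin n, Real.cos (((i : ℤ) - (j : ℤ) : ℤ) * φ + α) = Real.cos α ↔ i = j := by
    intro i j
    rw [hphase, Fin.ext_iff]
    constructor
    · intro h
      have := Int.eq_zero_of_abs_lt_dvd h (by rw [abs_lt]; omega)
      omega
    · intro h
      simp [h]
  refine hasOrthoRep_compl_prism_iff.2 ⟨fun p =>
    if p.2 = 0 then !₂[s, 0, Real.cos (p.1 * φ), Real.sin (p.1 * φ)]
    else !₂[u, t, Real.cos (p.1 * φ + α), Real.sin (p.1 * φ + α)], ?_⟩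
  rintro ⟨i, x⟩ ⟨j, y⟩ -
  have h1 := hadj i j
  have h2 := heq i j
  have h3 := heq j i
  fin_cases x <;> fin_cases y <;>
    simp only [PiLp.inner_apply, Fin.sum_univ_four] <;> simp
  · rw [← h1]
    push_cast
    rw [sub_mul, Real.cos_sub]
    constructor <;> intro h <;> linarith
  · rw [eq_comm (a := i), ← h3]
    push_cast
    rw [show ((j : ℝ) - i) * φ + α = (j * φ + α) - i * φ by ring, Real.cos_sub (j * φ + α)]
    constructor <;> intro h <;> linarith
  · rw [← h2]
    push_cast
    rw [show ((i : ℝ) - j) * φ + α = (i * φ + α) - j * φ by ring, Real.cos_sub (i * φ + α)]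
    constructor <;> intro h <;> linarith
  · rw [← h1]
    push_cast
    rw [show ((i : ℝ) - j) * φ = (i * φ + α) - (j * φ + α) by ring, Real.cos_sub]
    constructor <;> intro h <;> linarith

/-- A frequency `l` slightly below `n / 2` that is coprime to `n` yields a representation. -/
theorem hasOrthoRep_compl_prism_of_near_half {n : ℕ} {l m : ℤ} (hm : 0 ≤ m) (hml : n = 2 * l + m)
    (hmn : 4 * m + 1 ≤ 2 * n) (hn : 2 ≤ n) (hl : IsCoprime (n : ℤ) l) :
    HasOrthoRep ((cycleGraph n □ (⊤ : SimpleGraph (Fin 2)))ᶜ) 4 := by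
  have hpi := Real.pi_pos
  have hn0 : (0 : ℝ) < n := by positivity
  have hm' : (0 : ℝ) ≤ m := by exact_mod_cast hm
  have hmn' : 4 * (m : ℝ) + 1 ≤ 2 * n := by exact_mod_cast hmn
  have hml' : (n : ℝ) = 2 * l + m := by exact_mod_cast hml
  have hcos : Real.cos (2 * Real.pi * l / n) = -Real.cos (m * Real.pi / n) := by
    rw [← Real.cos_pi_sub]
    congr 1
    field_simp
    linarith
  have hα : |Real.cos (Real.pi / 2 + Real.pi / (4 * n))| =
      Real.cos (Real.pi / 2 - Real.pi / (4 * n)) := by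
    rw [Real.cos_pi_div_two_sub, add_comm, Real.cos_add_pi_div_two, abs_neg, abs_of_nonneg]
    refine Real.sin_nonneg_of_nonneg_of_le_pi (by positivity) (div_le_self hpi.le ?_)
    linarith
  have hangle : m * Real.pi / n ≤ Real.pi / 2 - Real.pi / (4 * n) := by
    field_simp
    linarith
  have hsmall : 0 < Real.pi / (4 * n) := by positivity
  have hpos : 0 ≤ m * Real.pi / n := by positivity
  refine hasOrthoRep_compl_prism_of_coprime hn hl ?_ ?_
  · rw [hcos, neg_lt_zero]
    exact Real.cos_pos_of_mem_Ioo ⟨by linarith, by linarith⟩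
  · rw [hcos, neg_neg, hα]
    exact Real.cos_le_cos_of_nonneg_of_le_pi hpos (by linarith) hangle

theorem hasOrthoRep_compl_prism {n : ℕ} (hn : 4 ≤ n) :
    HasOrthoRep ((cycleGraph n □ (⊤ : SimpleGraph (Fin 2)))ᶜ) 4 := by
  obtain rfl | rfl | hodd | h4 | h2 : n = 4 ∨ n = 6 ∨ (∃ k : ℕ, n = 2 * k + 1) ∨
      (8 ≤ n ∧ ∃ k : ℕ, n = 4 * k) ∨ (10 ≤ n ∧ ∃ k : ℕ, n = 4 * k + 2) := by
    have hdiv : n = 2 * (n / 2) + 1 ∨ n = 4 * (n / 4) ∨ n = 4 * (n / 4) + 2 := by omega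
    rcases hdiv with h | h | h
    · exact Or.inr (Or.inr (Or.inl ⟨_, h⟩))
    · by_cases h8 : 8 ≤ n
      · exact Or.inr (Or.inr (Or.inr (Or.inl ⟨h8, _, h⟩)))
      · omega
    · by_cases h10 : 10 ≤ n
      · exact Or.inr (Or.inr (Or.inr (Or.inr ⟨h10, _, h⟩)))
      · omega
  · exact hasOrthoRep_compl_prism_four
  · exact hasOrthoRep_compl_prism_six
  · obtain ⟨k, rfl⟩ := hodd
    refine hasOrthoRep_compl_prism_of_near_half (l := k) (m := 1) (by norm_num)
      (by push_cast; ring) (by omega) (by omega) ⟨1, -2, ?_⟩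
    push_cast
    ring
  · obtain ⟨hn8, k, rfl⟩ := h4
    refine hasOrthoRep_compl_prism_of_near_half (l := 2 * k - 1) (m := 2) (by norm_num)
      (by push_cast; ring) (by omega) (by omega) ⟨k, -(2 * k + 1), ?_⟩
    push_cast
    ring
  · obtain ⟨hn10, k, rfl⟩ := h2
    refine hasOrthoRep_compl_prism_of_near_half (l := 2 * k - 1) (m := 4) (by norm_num)
      (by push_cast; ring) (by omega) (by omega)
      ⟨-(k * (k - 1)), 2 * k - 1 + 2 * (k * (k - 1)), ?_⟩
    push_cast
    ring

theorem maxDegree_prism {n : ℕ} (hn : 3 ≤ n) :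
    (cycleGraph n □ (⊤ : SimpleGraph (Fin 2))).maxDegree = 3 := by
  obtain ⟨m, rfl⟩ := Nat.exists_eq_add_of_le' hn
  have hdeg (v) [Fintype ((cycleGraph (m + 3) □ (⊤ : SimpleGraph (Fin 2))).neighborSet v)] :
      (cycleGraph (m + 3) □ (⊤ : SimpleGraph (Fin 2))).degree v = 3 := by
    rw [degree_boxProd, cycleGraph_degree_three_le]
    simp
  refine le_antisymm (maxDegree_le_of_forall_degree_le _ _ fun v => by rw [hdeg]) ?_
  have hle := degree_le_maxDegree (cycleGraph (m + 3) □ (⊤ : SimpleGraph (Fin 2))) (0, 0)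
  rwa [hdeg] at hle

/-- For every `n ≥ 4`, the complement of the `n`-prism `Cₙ □ K₂` has an orthogonal
representation in `ℝ^4`; consequently `msr((Cₙ □ K₂)ᶜ) ≤ Δ(Cₙ □ K₂) + 1 = 4`. -/
theorem compl_prism_orthoRep (n : ℕ) (hn : 4 ≤ n) :
    HasOrthoRep ((cycleGraph n □ (⊤ : SimpleGraph (Fin 2)))ᶜ) 4 ∧
    msr ((cycleGraph n □ (⊤ : SimpleGraph (Fin 2)))ᶜ) ≤ 4 ∧
    (cycleGraph n □ (⊤ : SimpleGraph (Fin 2))).maxDegree + 1 = 4 := by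
  have hrep : HasOrthoRep ((cycleGraph n □ (⊤ : SimpleGraph (Fin 2)))ᶜ) 4 :=
    hasOrthoRep_compl_prism hn
  refine ⟨hrep, Nat.sInf_le hrep, ?_⟩
  exact congrArg (· + 1) (maxDegree_prism (by omega))
end
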